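/- Let (G, {G_(i)}), K, a_i, D_i, d_i, K_i, u_i, b_i be as in the ramification theorem for the generic tower, and for i ∉ Σ_G let l_i denote the total degree of D_i. If b_i > p^{i-2} l_i u_{i-1} for all i ∉ Σ_G (necessarily 2 ≤ i ≤ n), then the conclusions of the ramification theorem hold for the tower K_0, K_1, ..., K_n: K_n/K is Galois with group G with μ(Gal(K_n/K_i)) = G_(i), the upper and lower ramification breaks of K_n/K are u_1,...,u_n and b_1,...,b_n respectively, v_K(α_i) = −u_i/p, and the ramification subgroups of Gal(K_n/K) are exactly the Gal(K_n/K_i). -/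

import Mathlib

/-!
STATEMENT 14 (Corollary 4.5 of the paper):
With (G, {G_(i)}), K, a_i, D_i, d_i, K_i, u_i, b_i as in the ramification theorem for the
generic tower, and l_i the total degree of D_i: if b_i > p^{i-2} l_i u_{i-1} for all
i ∉ Σ_G (necessarily 2 ≤ i ≤ n), then the conclusions of the ramification theorem hold:
K_n/K is Galois with group G compatibly with the filtration, it is totally ramified with
upper breaks u_1,...,u_n and lower breaks b_1,...,b_n, v_K(α_i) = −u_i/p, and the
ramification subgroups of Gal(K_n/K) are exactly the Gal(K_n/K_i).
-/

/-- A normalized discrete valuation on a field `K` (so `v(K×) = ℤ`). -/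
structure DVal (K : Type*) [Field K] where
  v : K → ℤ
  v_one : v 1 = 0
  v_mul : ∀ x y : K, x ≠ 0 → y ≠ 0 → v (x * y) = v x + v y
  v_add : ∀ x y : K, x ≠ 0 → y ≠ 0 → x + y ≠ 0 → min (v x) (v y) ≤ v (x + y)
  exists_uniformizer : ∃ π : K, π ≠ 0 ∧ v π = 1

/-- `K` is complete with respect to the discrete valuation `vK`. -/
def DVal.IsComplete {K : Type*} [Field K] (vK : DVal K) : Prop :=
  ∀ f : ℕ → K,
    (∀ N : ℤ, ∃ M : ℕ, ∀ m n : ℕ, M ≤ m → M ≤ n → f m = f n ∨ N ≤ vK.v (f m - f n)) →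
    ∃ a : K, ∀ N : ℤ, ∃ M : ℕ, ∀ m : ℕ, M ≤ m → f m = a ∨ N ≤ vK.v (f m - a)

/-- The residue field of `(K, vK)` is perfect (in characteristic `p` this says the
Frobenius is surjective on the residue field). -/
def DVal.PerfectResidue {K : Type*} [Field K] (vK : DVal K) (p : ℕ) : Prop :=
  ∀ x : K, (x = 0 ∨ 0 ≤ vK.v x) →
    ∃ y : K, (y = 0 ∨ 0 ≤ vK.v y) ∧ (x - y ^ p = 0 ∨ 1 ≤ vK.v (x - y ^ p))

/-- `σ` belongs to the inertia subgroup: it induces the identity on the residue field. -/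
def inInertia (K : Type*) {L : Type*} [Field K] [Field L] [Algebra K L]
    (vL : DVal L) (σ : L ≃ₐ[K] L) : Prop :=
  ∀ x : L, (x = 0 ∨ 0 ≤ vL.v x) → (σ x - x = 0 ∨ 1 ≤ vL.v (σ x - x))

/-- The ramification number `i(σ) = v_L(σ(π_L) − π_L) − 1` for `σ` in the inertia group,
and `i(σ) = −1` otherwise. -/
noncomputable def ramNum (K : Type*) {L : Type*} [Field K] [Field L] [Algebra K L]
    (vL : DVal L) (πL : L) (σ : L ≃ₐ[K] L) : ℤ := by
  classical exact if inInertia K vL σ then vL.v (σ πL - πL) - 1 else -1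

/-- The lower ramification set `G_t = {σ : i(σ) ≥ t}` (together with the identity). -/
def lowerSet (K : Type*) {L : Type*} [Field K] [Field L] [Algebra K L]
    (vL : DVal L) (πL : L) (t : ℝ) : Set (L ≃ₐ[K] L) :=
  {σ | σ = 1 ∨ (t ≤ (ramNum K vL πL σ : ℝ))}

/-- `b` is a lower ramification break of `L/K`. -/
def IsLowerBreak (K : Type*) {L : Type*} [Field K] [Field L] [Algebra K L]
    (vL : DVal L) (πL : L) (b : ℝ) : Prop :=
  ∃ σ : L ≃ₐ[K] L, σ ≠ 1 ∧ (ramNum K vL πL σ : ℝ) = b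

/-- The Hasse–Herbrand function `φ_{L/K}(x) = ∫_0^x dt / (G_0 : G_t)`. -/
noncomputable def hherb (K : Type*) {L : Type*} [Field K] [Field L] [Algebra K L]
    (vL : DVal L) (πL : L) (x : ℝ) : ℝ :=
  ∫ t in (0:ℝ)..x,
    (Nat.card ↥(lowerSet K vL πL t) : ℝ) / (Nat.card ↥(lowerSet K vL πL 0) : ℝ)

/-- `u` is an upper ramification break of `L/K`:  `ψ_{L/K}(u)` is a lower break. -/
def IsUpperBreak (K : Type*) {L : Type*} [Field K] [Field L] [Algebra K L]
    (vL : DVal L) (πL : L) (u : ℝ) : Prop :=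
  ∃ b : ℝ, IsLowerBreak K vL πL b ∧ hherb K vL πL b = u

open MvPolynomial in
/-- `i ∈ Σ_G`: the extension of `G/G_(i-1)` by `G_(i-1)/G_(i)` given by the quotient
`G/G_(i)` is split. -/
def splitAt {G : Type*} [Group G] (Gser : ℕ → Subgroup G) [∀ j, (Gser j).Normal]
    (i : ℕ) : Prop :=
  ∃ H : Subgroup (G ⧸ Gser i),
    ((Gser (i - 1)).map (QuotientGroup.mk' (Gser i))).IsComplement' H

open MvPolynomial in
/-- The element `X_j = Y_j^p − Y_j − D_j(Y_1,...,Y_{j-1})` of `S_i = F_p[Y_1,...,Y_i]`. -/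
noncomputable def Xelt (p : ℕ) (D : (j : ℕ) → MvPolynomial (Fin (j - 1)) (ZMod p))
    (i j : ℕ) (h : j - 1 < i) : MvPolynomial (Fin i) (ZMod p) :=
  X (⟨j - 1, h⟩ : Fin i) ^ p - X (⟨j - 1, h⟩ : Fin i) -
    rename (Fin.castLE (le_of_lt h)) (D j)

/-- The set of generators `X_1, ..., X_i` of `R_i ⊆ S_i`. -/
noncomputable def XeltSet (p : ℕ) (D : (j : ℕ) → MvPolynomial (Fin (j - 1)) (ZMod p))
    (i : ℕ) : Set (MvPolynomial (Fin i) (ZMod p)) :=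
  {q | ∃ (j : ℕ) (h1 : 1 ≤ j) (h2 : j ≤ i), q = Xelt p D i j (by omega)}

open MvPolynomial in
/-- The family `D_1, ..., D_n` satisfies the conditions of Saltman's generic construction
(Proposition 3.5 of the paper). -/
def IsSaltmanFamily (p n : ℕ) (G : Type*) [Group G]
    (Gser : ℕ → Subgroup G) [∀ j, (Gser j).Normal]
    (D : (j : ℕ) → MvPolynomial (Fin (j - 1)) (ZMod p)) : Prop :=
  (∀ i, 1 ≤ i → i ≤ n →
    (splitAt Gser i → D i = 0) ∧
    (¬ splitAt Gser i → ∀ c : ZMod p, D i ≠ C c)) ∧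
  ∃ ρ : (i : ℕ) → (G ⧸ Gser i) →* RingAut (MvPolynomial (Fin i) (ZMod p)),
    ∀ i, 1 ≤ i → i ≤ n →
      Function.Injective (ρ i) ∧
      (∀ q : MvPolynomial (Fin i) (ZMod p),
        (∀ g : G ⧸ Gser i, ρ i g q = q) ↔
          q ∈ Algebra.adjoin (ZMod p) (XeltSet p D i)) ∧
      (∀ M : Ideal (MvPolynomial (Fin i) (ZMod p)), M.IsMaximal →
        ∀ g : G ⧸ Gser i, g ≠ 1 →
          ∃ s : MvPolynomial (Fin i) (ZMod p), ρ i g s - s ∉ M) ∧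
      (∀ g : G, ∀ q : MvPolynomial (Fin (i - 1)) (ZMod p),
        ρ i (QuotientGroup.mk g) (rename (Fin.castLE (Nat.sub_le i 1)) q) =
          rename (Fin.castLE (Nat.sub_le i 1)) (ρ (i - 1) (QuotientGroup.mk g) q))

/-- The set {α_1, ..., α_i}. -/
def towerSet {L : Type*} (α : ℕ → L) (i : ℕ) : Set L :=
  {x | ∃ j, 1 ≤ j ∧ j ≤ i ∧ x = α j}

/-- The tower of fields K_i = K(α_1, ..., α_i) inside L = K_n. -/
noncomputable def towerField (K : Type*) {L : Type*} [Field K] [Field L] [Algebra K L]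
    (α : ℕ → L) (i : ℕ) : IntermediateField K L :=
  IntermediateField.adjoin K (towerSet α i)



namespace DVal

section basic
variable {L : Type*} [Field L] (w : DVal L)

/-- valuation at least `N` -/
def G (N : ℤ) (x : L) : Prop := x = 0 ∨ N ≤ w.v x

/-- valuation exactly `N` -/
def E (N : ℤ) (x : L) : Prop := x ≠ 0 ∧ w.v x = N

variable {w}

theorem v_neg (x : L) : w.v (-x) = w.v x := by
  by_cases hx : x = 0
  · simp [hx]
  have h1 : w.v (-1) = 0 := by
    have := w.v_mul (-1) (-1) (by simp) (by simp)
    rw [neg_mul_neg, one_mul, w.v_one] at this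
    omega
  have := w.v_mul (-1) x (by simp) hx
  rw [neg_one_mul] at this
  omega

theorem E.G {N : ℤ} {x : L} (h : w.E N x) : w.G N x := Or.inr h.2.ge

theorem E.of_ne {x : L} (h : x ≠ 0) : w.E (w.v x) x := ⟨h, rfl⟩

theorem E.congr {N M : ℤ} {x : L} (h : w.E N x) (e : N = M) : w.E M x := e ▸ h

theorem G.mono {N M : ℤ} {x : L} (h : w.G N x) (hM : M ≤ N) : w.G M x :=
  h.imp id (fun h => hM.trans h)

theorem G.zero (N : ℤ) : w.G N 0 := Or.inl rfl

theorem G.le {N : ℤ} {x : L} (h : w.G N x) (hx : x ≠ 0) : N ≤ w.v x := h.resolve_left hx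

theorem G.add {N : ℤ} {x y : L} (hx : w.G N x) (hy : w.G N y) : w.G N (x + y) := by
  by_cases h : x = 0
  · simpa [h] using hy
  by_cases h' : y = 0
  · simpa [h'] using hx
  by_cases h'' : x + y = 0
  · exact Or.inl h''
  exact Or.inr ((le_min (hx.le h) (hy.le h')).trans (w.v_add x y h h' h''))

theorem G.neg {N : ℤ} {x : L} (hx : w.G N x) : w.G N (-x) := by
  rcases hx with h | h
  · left; simp [h]
  · right; rwa [v_neg]

theorem G.sub {N : ℤ} {x y : L} (hx : w.G N x) (hy : w.G N y) : w.G N (x - y) := by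
  rw [sub_eq_add_neg]; exact hx.add hy.neg

theorem G.mul {N M : ℤ} {x y : L} (hx : w.G N x) (hy : w.G M y) : w.G (N + M) (x * y) := by
  by_cases h : x = 0
  · left; simp [h]
  by_cases h' : y = 0
  · left; simp [h']
  right
  rw [w.v_mul x y h h']
  exact add_le_add (hx.le h) (hy.le h')

theorem E.mul {N M : ℤ} {x y : L} (hx : w.E N x) (hy : w.E M y) : w.E (N + M) (x * y) :=
  ⟨mul_ne_zero hx.1 hy.1, by rw [w.v_mul x y hx.1 hy.1, hx.2, hy.2]⟩

theorem E.one : w.E 0 (1 : L) := ⟨one_ne_zero, w.v_one⟩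

theorem E.pow {N : ℤ} {x : L} (hx : w.E N x) (k : ℕ) : w.E (k * N) (x ^ k) := by
  induction k with
  | zero => simpa using E.one
  | succ k ih =>
    rw [pow_succ]
    exact (ih.mul hx).congr (by push_cast; ring)

theorem G.pow {N : ℤ} {x : L} (hx : w.G N x) (k : ℕ) : w.G (k * N) (x ^ k) := by
  induction k with
  | zero => simpa using (E.one (w := w)).G
  | succ k ih =>
    rw [pow_succ]
    exact (ih.mul hx).mono (by push_cast; linarith)

theorem E.neg {N : ℤ} {x : L} (hx : w.E N x) : w.E N (-x) :=
  ⟨neg_ne_zero.2 hx.1, by rw [v_neg]; exact hx.2⟩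

theorem E.inv {N : ℤ} {x : L} (hx : w.E N x) : w.E (-N) x⁻¹ := by
  refine ⟨inv_ne_zero hx.1, ?_⟩
  have := w.v_mul x x⁻¹ hx.1 (inv_ne_zero hx.1)
  rw [mul_inv_cancel₀ hx.1, w.v_one, hx.2] at this
  omega

theorem E.add_G {N : ℤ} {x z : L} (hx : w.E N x) (hz : w.G (N + 1) z) : w.E N (x + z) := by
  have hne : x + z ≠ 0 := by
    intro h
    have : z = -x := by linear_combination h
    subst this
    have := hz.le (neg_ne_zero.2 hx.1)
    rw [v_neg, hx.2] at this
    omega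
  refine ⟨hne, le_antisymm ?_ ?_⟩
  · by_contra hlt
    push Not at hlt
    have h1 : w.G (N + 1) (x + z) := Or.inr hlt
    have h2 := h1.sub hz
    rw [add_sub_cancel_right] at h2
    have := h2.le hx.1
    rw [hx.2] at this
    omega
  · exact (hx.G.add (hz.mono (by omega))).le hne

theorem G.sum {ι : Type*} {N : ℤ} (S : Finset ι) (t : ι → L) (h : ∀ s ∈ S, w.G N (t s)) :
    w.G N (∑ s ∈ S, t s) := by
  classical
  induction S using Finset.induction_on with
  | empty => simpa using G.zero N
  | insert a S ha ih =>
    rw [Finset.sum_insert ha]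
    exact (h a (by simp)).add (ih fun s hs => h s (by simp [hs]))

theorem E.sum {ι : Type*} [DecidableEq ι] {N : ℤ} (S : Finset ι) (t : ι → L) (s0 : ι) (h0 : s0 ∈ S)
    (hE : w.E N (t s0)) (h : ∀ s ∈ S, s ≠ s0 → w.G (N + 1) (t s)) :
    w.E N (∑ s ∈ S, t s) := by
  rw [← Finset.add_sum_erase S t h0]
  exact hE.add_G (G.sum _ _ fun s hs => h s (Finset.mem_of_mem_erase hs) (Finset.ne_of_mem_erase hs))

/-- terms with pairwise distinct valuations -/
theorem exists_min {ι : Type*} [DecidableEq ι] (S : Finset ι) (t : ι → L)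
    (hd : ∀ s ∈ S, ∀ s' ∈ S, t s ≠ 0 → t s' ≠ 0 → w.v (t s) = w.v (t s') → s = s')
    (hne : ∃ s ∈ S, t s ≠ 0) :
    ∃ s0 ∈ S, t s0 ≠ 0 ∧ (∀ s ∈ S, s ≠ s0 → w.G (w.v (t s0) + 1) (t s)) ∧
      w.E (w.v (t s0)) (∑ s ∈ S, t s) := by
  classical
  obtain ⟨s1, hs1, hs1'⟩ := hne
  obtain ⟨s0, hs0, hmin⟩ := Finset.exists_min_image (S.filter fun s => t s ≠ 0)
    (fun s => w.v (t s)) ⟨s1, by simp [hs1, hs1']⟩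
  rw [Finset.mem_filter] at hs0
  have key : ∀ s ∈ S, s ≠ s0 → w.G (w.v (t s0) + 1) (t s) := by
    intro s hs hss
    by_cases hts : t s = 0
    · exact Or.inl hts
    right
    have h1 := hmin s (by simp [hs, hts])
    have h2 : w.v (t s) ≠ w.v (t s0) := fun h => hss (hd s hs s0 hs0.1 hts hs0.2 h)
    omega
  exact ⟨s0, hs0.1, hs0.2, key, E.sum S t s0 hs0.1 (E.of_ne hs0.2) key⟩

theorem pow_expand {A B : ℤ} {x z : L} (hx : w.E A x) (hz : w.E B z) (hAB : A < B) (s : ℕ) :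
    w.G (s * A + B + 1) ((x + z) ^ (s + 1) - x ^ (s + 1) - ((s + 1 : ℕ) : L) * (x ^ s * z)) := by
  induction s with
  | zero => left; simp
  | succ s ih =>
    have hnat : ∀ k : ℕ, w.G 0 ((k : ℕ) : L) := by
      intro k
      induction k with
      | zero => left; simp
      | succ k ih => push_cast; exact ih.add E.one.G
    have h1 := ih.mul ((hx.add_G (hz.G.mono (by omega))).G)
    have h2 := (hnat (s + 1)).mul (((hx.pow s).mul (hz.mul hz)).G)
    have : (x + z) ^ (s + 1 + 1) - x ^ (s + 1 + 1) - ((s + 1 + 1 : ℕ) : L) * (x ^ (s + 1) * z) =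
      ((x + z) ^ (s + 1) - x ^ (s + 1) - ((s + 1 : ℕ) : L) * (x ^ s * z)) * (x + z)
        + ((s + 1 : ℕ) : L) * (x ^ s * (z * z)) := by
      push_cast; ring
    rw [this]
    refine (h1.mono ?_).add (h2.mono ?_)
    · push_cast; linarith
    · push_cast; linarith

theorem E.of_pow_eq_one {x : L} {k : ℕ} (hk : 0 < k) (h : x ^ k = 1) : w.E 0 x := by
  have hx : x ≠ 0 := by
    rintro rfl
    rw [zero_pow hk.ne'] at h
    exact zero_ne_one h
  refine ⟨hx, ?_⟩
  have := ((E.of_ne (w := w) hx).pow k).2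
  rw [h, w.v_one] at this
  rcases mul_eq_zero.1 this.symm with h | h
  · omega
  · exact h

theorem E.of_frob {p : ℕ} (hp : p.Prime) {x : L} (hx : x ≠ 0) (h : x ^ p = x) : w.E 0 x := by
  have := hp.two_le
  refine E.of_pow_eq_one (k := p - 1) (by omega) ?_
  have h2 : x ^ p = x ^ (p - 1) * x := by rw [← pow_succ]; congr 1; omega
  rw [h2] at h
  exact mul_right_cancel₀ hx (by rw [h, one_mul])

theorem natCast_frob (p : ℕ) (hp : p.Prime) [CharP L p] (k : ℕ) : ((k : L)) ^ p = k := by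
  haveI := Fact.mk hp
  haveI : ExpChar L p := ExpChar.prime hp
  exact (map_natCast (frobenius L p) k)

theorem G.natCast (k : ℕ) : w.G 0 ((k : ℕ) : L) := by
  induction k with
  | zero => left; simp
  | succ k ih => push_cast; exact ih.add E.one.G

/-- difference of powers, general bound -/
theorem pow_sub_G {A B : ℤ} {x z : L} (hx : w.E A x) (hz : w.E B z) (hAB : A < B) (s : ℕ) :
    w.G (s * A - A + B) ((x + z) ^ s - x ^ s) := by
  rcases s with _ | s
  · left; simp
  have h1 := pow_expand hx hz hAB s
  have h2 := (G.natCast (w := w) (s + 1)).mul (((hx.pow s).mul hz).G)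
  have := (h1.mono (M := ((s + 1 : ℕ) : ℤ) * A - A + B) (by push_cast; linarith)).add
    (h2.mono (M := ((s + 1 : ℕ) : ℤ) * A - A + B) (by push_cast; linarith))
  rwa [sub_add_cancel] at this

/-- difference of powers, exact -/
theorem pow_sub_E (p : ℕ) (hp : p.Prime) [CharP L p] {A B : ℤ} {x z : L} (hx : w.E A x)
    (hz : w.E B z) (hAB : A < B) (s : ℕ) (hs : ¬ p ∣ s) :
    w.E (s * A - A + B) ((x + z) ^ s - x ^ s) := by
  rcases s with _ | s
  · simp at hs
  have h1 := pow_expand hx hz hAB s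
  have h0 : ((s + 1 : ℕ) : L) ≠ 0 := by
    rwa [Ne, CharP.cast_eq_zero_iff L p]
  have h2 := ((E.of_frob (w := w) hp h0 (natCast_frob p hp _)).mul ((hx.pow s).mul hz)).add_G
    (h1.mono (by linarith))
  rw [add_sub_cancel] at h2
  exact h2.congr (by push_cast; ring)

/-- valuation of an Artin-Schreier root -/
theorem AS_root {p : ℕ} (hp : p.Prime) {N : ℤ} (hN : N < 0) {z h : L} (hz : z ^ p - z = h)
    (hh : w.E N h) : ∃ k, w.E k z ∧ (p : ℤ) * k = N ∧ k < 0 := by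
  have hp2 := hp.two_le
  have hp2' : (2 : ℤ) ≤ p := by exact_mod_cast hp2
  have hz0 : z ≠ 0 := by
    rintro rfl
    rw [zero_pow hp.ne_zero, sub_zero] at hz
    exact hh.1 hz.symm
  have hE := E.of_ne (w := w) hz0
  have hneg : w.v z < 0 := by
    by_contra hcon
    push Not at hcon
    have h1 : w.G 0 z := Or.inr hcon
    have h2 := ((h1.pow p).mono (M := 0) (by simp)).sub h1
    rw [hz] at h2
    have := h2.le hh.1
    rw [hh.2] at this
    omega
  refine ⟨w.v z, hE, ?_, hneg⟩
  have h3 := (hE.pow p).add_G (z := -z) (hE.neg.G.mono (by nlinarith))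
  rw [← sub_eq_add_neg, hz] at h3
  rw [← h3.2, hh.2]

end basic

end DVal

theorem bezout_mod {p : ℕ} (hp : p.Prime) {b : ℤ} (hb : ¬ (p : ℤ) ∣ b) (r : ℤ) :
    ∃ s : ℕ, s < p ∧ ∃ q : ℤ, r = s * b + p * q := by
  haveI := Fact.mk hp
  have hb' : (b : ZMod p) ≠ 0 := by
    rwa [Ne, ZMod.intCast_zmod_eq_zero_iff_dvd]
  refine ⟨((r : ZMod p) * (b : ZMod p)⁻¹).val, ZMod.val_lt _, ?_⟩
  have : (p : ℤ) ∣ r - (((r : ZMod p) * (b : ZMod p)⁻¹).val : ℤ) * b := by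
    rw [← ZMod.intCast_zmod_eq_zero_iff_dvd]
    push_cast
    rw [ZMod.natCast_zmod_val, mul_assoc, inv_mul_cancel₀ hb', mul_one, sub_self]
  obtain ⟨q, hq⟩ := this
  exact ⟨q, by linarith⟩


section levels
variable {K L : Type*} [Field K] [Field L] [Algebra K L]

/-- A subfield with value group `mℤ` and perfect residue field. -/
structure Lev (p : ℕ) (w : DVal L) (F : IntermediateField K L) (m : ℤ) : Prop where
  pos : 0 < m
  dvd : ∀ x ∈ F, x ≠ 0 → m ∣ w.v x
  ex : ∀ k : ℤ, ∃ x ∈ F, w.E (m * k) x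
  res : ∀ x ∈ F, w.G 0 x → ∃ y ∈ F, w.G 0 y ∧ w.G 1 (x - y ^ p)

/-- A totally ramified Artin-Schreier step `M = F(y)` with break `b`. -/
structure Stp (p : ℕ) (w : DVal L) (F M : IntermediateField K L) (m b : ℤ) (y : L) : Prop where
  lev : Lev p w F (p * m)
  le : F ≤ M
  ymem : y ∈ M
  yE : w.E (-(m * b)) y
  fmem : y ^ p - y ∈ F
  bpos : 0 < b
  ndvd : ¬ (p : ℤ) ∣ b
  dec : ∀ x ∈ M, ∃ c : ℕ → L, (∀ s, c s ∈ F) ∧ x = ∑ s ∈ Finset.range p, c s * y ^ s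

variable {p : ℕ} {w : DVal L} {F M : IntermediateField K L} {m b : ℤ} {y : L}

theorem Stp.mpos (h : Stp p w F M m b y) : 0 < m := by
  have := h.lev.pos
  have h2 : (0 : ℤ) ≤ p := by positivity
  exact pos_of_mul_pos_right this h2

theorem Stp.fE (hp : p.Prime) (h : Stp p w F M m b y) : w.E (-(p * m * b)) (y ^ p - y) := by
  have hp2 : (2 : ℤ) ≤ p := by exact_mod_cast hp.two_le
  have h1 : 0 < m * b := mul_pos h.mpos h.bpos
  rw [sub_eq_add_neg]
  refine ((h.yE.pow p).add_G (h.yE.neg.G.mono (by nlinarith))).congr (by ring)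

theorem Stp.term (h : Stp p w F M m b y) {c : L} (hc : c ∈ F) (hc0 : c ≠ 0) (s : ℕ) :
    ∃ k : ℤ, w.v c = p * m * k ∧ w.E (m * (p * k - s * b)) (c * y ^ s) := by
  obtain ⟨k, hk⟩ := h.lev.dvd c hc hc0
  refine ⟨k, hk, ?_⟩
  exact ((DVal.E.of_ne hc0).mul (h.yE.pow s)).congr (by rw [hk]; ring)

theorem Stp.min (hp : p.Prime) (h : Stp p w F M m b y) {x : L} (hx : x ∈ M) (hx0 : x ≠ 0) :
    ∃ c : ℕ → L, (∀ s, c s ∈ F) ∧ x = ∑ s ∈ Finset.range p, c s * y ^ s ∧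
      ∃ s0 < p, c s0 ≠ 0 ∧ w.v x = w.v (c s0 * y ^ s0) ∧
        ∀ s < p, s ≠ s0 → w.G (w.v x + 1) (c s * y ^ s) := by
  obtain ⟨c, hc, hsum⟩ := h.dec x hx
  refine ⟨c, hc, hsum, ?_⟩
  have hy0 := h.yE.1
  obtain ⟨s0, hs0, hne, hlt, hE⟩ := DVal.exists_min (w := w) (Finset.range p)
    (fun s => c s * y ^ s) (by
      intro s hs s' hs' h1 h2 hv
      obtain ⟨k, -, hk⟩ := h.term (hc s) (left_ne_zero_of_mul h1) s
      obtain ⟨k', -, hk'⟩ := h.term (hc s') (left_ne_zero_of_mul h2) s'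
      rw [hk.2, hk'.2] at hv
      have h3 := mul_left_cancel₀ h.mpos.ne' hv
      have h4 : (p : ℤ) ∣ ((s : ℤ) - s') * b := ⟨k - k', by linarith⟩
      have h5 := (Int.Prime.dvd_mul' hp h4).resolve_right h.ndvd
      rw [Finset.mem_range] at hs hs'
      have h6 := Int.eq_zero_of_abs_lt_dvd h5 (by rw [abs_lt]; omega)
      omega) (by
      by_contra hcon
      push Not at hcon
      exact hx0 (hsum.trans (Finset.sum_eq_zero hcon)))
  rw [← hsum] at hE
  refine ⟨s0, Finset.mem_range.1 hs0, left_ne_zero_of_mul hne, hE.2, ?_⟩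
  intro s hs hss
  rw [hE.2]
  exact hlt s (Finset.mem_range.2 hs) hss

theorem Stp.lev' (hp : p.Prime) (h : Stp p w F M m b y) : Lev p w M m where
  pos := h.mpos
  dvd := by
    intro x hx hx0
    obtain ⟨c, hc, -, s0, -, hc0, hv, -⟩ := h.min hp hx hx0
    obtain ⟨k, -, hk⟩ := h.term (hc s0) hc0 s0
    rw [hv, hk.2]
    exact dvd_mul_right _ _
  ex := by
    intro k
    obtain ⟨s, -, q, hq⟩ := bezout_mod hp h.ndvd (-k)
    obtain ⟨g, hg, hgE⟩ := h.lev.ex (-q)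
    exact ⟨g * y ^ s, mul_mem (h.le hg) (pow_mem h.ymem s),
      (hgE.mul (h.yE.pow s)).congr (by linear_combination m * hq)⟩
  res := by
    intro x hx hG
    by_cases hx0 : x = 0
    · exact ⟨0, zero_mem _, DVal.G.zero _, by left; simp [hx0, hp.ne_zero]⟩
    have hx1 := hG.le hx0
    obtain ⟨c, hc, hsum, s0, hs0, hc0, hv, hlt⟩ := h.min hp hx hx0
    have hall : ∀ s < p, w.G 0 (c s * y ^ s) := by
      intro s hs
      by_cases hss : s = s0
      · subst hss; right; omega
      · exact (hlt s hs hss).mono (by omega)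
    have hdiff : w.G 1 (x - c 0) := by
      have : x - c 0 = ∑ s ∈ (Finset.range p).erase 0, c s * y ^ s := by
        rw [hsum, ← Finset.add_sum_erase (Finset.range p) _ (Finset.mem_range.2 hp.pos)]
        simp
      rw [this]
      refine DVal.G.sum _ _ ?_
      intro s hs
      rw [Finset.mem_erase, Finset.mem_range] at hs
      by_cases hcs : c s = 0
      · left; simp [hcs]
      obtain ⟨k, -, hk⟩ := h.term (hc s) hcs s
      right
      have h1 := (hall s hs.2).le hk.1
      rw [hk.2] at h1 ⊢
      have h2 : (p : ℤ) * k - s * b ≠ 0 := by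
        intro h3
        have h4 : (p : ℤ) ∣ (s : ℤ) * b := ⟨k, by linarith⟩
        have h5 := (Int.Prime.dvd_mul' hp h4).resolve_right h.ndvd
        have h6 : p ∣ s := by exact_mod_cast h5
        have := Nat.le_of_dvd (by omega) h6
        omega
      have h3 := mul_ne_zero h.mpos.ne' h2
      omega
    have h0 : w.G 0 (c 0) := by simpa using hall 0 hp.pos
    obtain ⟨z, hz, hz0, hz1⟩ := h.lev.res (c 0) (hc 0) h0
    refine ⟨z, h.le hz, hz0, ?_⟩
    have := hdiff.add hz1
    rwa [sub_add_sub_cancel] at this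

/-- leading term `f^s g^p` -/
theorem Stp.leading (hp : p.Prime) (h : Stp p w F M m b y) {a : L} {r : ℤ} (ha : a ∈ F)
    (haE : w.E (-(p * m * r)) a) :
    ∃ (s : ℕ) (g : L) (k : ℤ), g ∈ F ∧ w.E (p * m * k) g ∧ r = s * b - p * k ∧
      w.G (-(p * m * r) + p * m) (a - (y ^ p - y) ^ s * g ^ p) := by
  obtain ⟨s, -, q, hq⟩ := bezout_mod hp h.ndvd r
  obtain ⟨g0, hg0, hg0E⟩ := h.lev.ex (-q)
  have hfE := h.fE hp
  set f := y ^ p - y with hf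
  have hden : w.E (-(p * m * r)) (f ^ s * g0 ^ p) :=
    ((hfE.pow s).mul (hg0E.pow p)).congr (by rw [hq]; ring)
  have hdmem : f ^ s * g0 ^ p ∈ F := mul_mem (pow_mem h.fmem s) (pow_mem hg0 p)
  have hx : w.E 0 (a * (f ^ s * g0 ^ p)⁻¹) := (haE.mul hden.inv).congr (by ring)
  obtain ⟨z, hz, hz0, hz1⟩ := h.lev.res _ (mul_mem ha (inv_mem hdmem)) hx.G
  have hzp : w.E 0 (z ^ p) := by
    have := hx.add_G (z := -(a * (f ^ s * g0 ^ p)⁻¹ - z ^ p)) (hz1.neg.mono (by omega))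
    have e : a * (f ^ s * g0 ^ p)⁻¹ + -(a * (f ^ s * g0 ^ p)⁻¹ - z ^ p) = z ^ p := by ring
    rwa [e] at this
  have hzne : z ≠ 0 := by
    rintro rfl
    exact hzp.1 (zero_pow hp.ne_zero)
  have hzE : w.E 0 z := by
    have h1 := (DVal.E.of_ne (w := w) hzne)
    refine h1.congr ?_
    have h2 := (h1.pow p).2
    rw [hzp.2] at h2
    rcases mul_eq_zero.1 h2.symm with h3 | h3
    · exact absurd (by exact_mod_cast h3) hp.ne_zero
    · exact h3
  refine ⟨s, g0 * z, -q, mul_mem hg0 hz, (hg0E.mul hzE).congr (by ring), by linarith, ?_⟩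
  have e : a - f ^ s * (g0 * z) ^ p = (f ^ s * g0 ^ p) * (a * (f ^ s * g0 ^ p)⁻¹ - z ^ p) := by
    rw [mul_sub, mul_comm a, mul_inv_cancel_left₀ hden.1]; ring
  have hG := hden.G.mul hz1
  rw [← e] at hG
  by_cases h0 : a - f ^ s * (g0 * z) ^ p = 0
  · exact Or.inl h0
  right
  have h1 := hG.le h0
  obtain ⟨k, hk⟩ := h.lev.dvd _ (sub_mem ha (mul_mem (pow_mem h.fmem s)
    (pow_mem (mul_mem hg0 hz) p))) h0
  rw [hk] at h1 ⊢
  have hpos := h.lev.pos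
  have h2 : (p : ℤ) * m * (-r) < p * m * k := by linarith
  have h3 := lt_of_mul_lt_mul_left h2 hpos.le
  have h4 : -r + 1 ≤ k := h3
  nlinarith

theorem Stp.lead_G (hp : p.Prime) (h : Stp p w F M m b y) {g : L} {k : ℤ} (s : ℕ)
    (hg : w.E (p * m * k) g) :
    w.G (-(p * m * (s * b - p * k)) + (p - 1) * m * b)
      ((y ^ p - y) ^ s * g ^ p - (y ^ s * g) ^ p) := by
  have hp2 : (2 : ℤ) ≤ p := by exact_mod_cast hp.two_le
  have h1 : 0 < m * b := mul_pos h.mpos h.bpos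
  have := (DVal.pow_sub_G (h.fE hp) h.yE (by nlinarith) s).neg.mul (hg.pow p).G
  have e : -((y ^ p - y + y) ^ s - (y ^ p - y) ^ s) * g ^ p =
      (y ^ p - y) ^ s * g ^ p - (y ^ s * g) ^ p := by
    rw [sub_add_cancel]; ring
  rw [e] at this
  exact this.mono (by linarith)

theorem Stp.lead_E (hp : p.Prime) [CharP L p] (h : Stp p w F M m b y) {g : L} {k : ℤ} (s : ℕ)
    (hs : ¬ p ∣ s) (hg : w.E (p * m * k) g) :
    w.E (-(p * m * (s * b - p * k)) + (p - 1) * m * b)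
      ((y ^ p - y) ^ s * g ^ p - (y ^ s * g) ^ p) := by
  have hp2 : (2 : ℤ) ≤ p := by exact_mod_cast hp.two_le
  have h1 : 0 < m * b := mul_pos h.mpos h.bpos
  have := (DVal.pow_sub_E p hp (h.fE hp) h.yE (by nlinarith) s hs).neg.mul (hg.pow p)
  have e : -((y ^ p - y + y) ^ s - (y ^ p - y) ^ s) * g ^ p =
      (y ^ p - y) ^ s * g ^ p - (y ^ s * g) ^ p := by
    rw [sub_add_cancel]; ring
  rw [e] at this
  exact this.congr (by ring)

theorem Stp.approx (hp : p.Prime) [CharP L p] (h : Stp p w F M m b y) (T : ℤ) (N : ℕ) :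
    ∀ (r : ℤ) (a : L), a ∈ F → w.G (-(p * m * r)) a → T ≤ -(p * m * r) + (p - 1) * m * b →
      T ≤ -(p * m * r) + p * m * N →
      ∃ z ∈ M, w.G (-(m * r)) z ∧ w.G T (a - z ^ p) := by
  have hchar : ∀ x z : L, (x + z) ^ p = x ^ p + z ^ p := by
    have := Fact.mk hp
    intro x z
    exact add_pow_char x z p
  have hmpos := h.mpos
  have hpm := h.lev.pos
  induction N with
  | zero =>
    intro r a ha hG h1 h2
    refine ⟨0, zero_mem _, DVal.G.zero _, ?_⟩
    rw [zero_pow hp.ne_zero, sub_zero]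
    exact hG.mono (by simpa using h2)
  | succ N ih =>
    intro r a ha hG h1 h2
    push_cast at h2
    by_cases hE : w.E (-(p * m * r)) a
    · obtain ⟨s, g, k, hg, hgE, hr, hG'⟩ := h.leading hp ha hE
      obtain ⟨z, hz, hzG, hzT⟩ := ih (r - 1) (a - (y ^ p - y) ^ s * g ^ p)
        (sub_mem ha (mul_mem (pow_mem h.fmem s) (pow_mem hg p))) (hG'.mono (by linarith))
        (by linarith) (by linarith)
      refine ⟨y ^ s * g + z, add_mem (mul_mem (pow_mem h.ymem s) (h.le hg)) hz, ?_, ?_⟩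
      · refine DVal.G.add ?_ (hzG.mono (by linarith))
        exact ((h.yE.pow s).mul hgE).G.mono (le_of_eq (by rw [hr]; ring))
      · have h3 := (h.lead_G hp s hgE).mono (M := T) (by rw [← hr]; exact h1)
        have := h3.add hzT
        have e : (y ^ p - y) ^ s * g ^ p - (y ^ s * g) ^ p +
            (a - (y ^ p - y) ^ s * g ^ p - z ^ p) = a - (y ^ s * g + z) ^ p := by
          rw [hchar]; ring
        rwa [e] at this
    · have hG' : w.G (-(p * m * (r - 1))) a := by
        by_cases h0 : a = 0
        · exact Or.inl h0
        right
        have h3 := hG.le h0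
        have h4 : w.v a ≠ -(p * m * r) := fun h => hE ⟨h0, h⟩
        obtain ⟨k, hk⟩ := h.lev.dvd a ha h0
        rw [hk] at h3 h4 ⊢
        have h5 : (p : ℤ) * m * (-r) < p * m * k := by
          have := lt_of_le_of_ne h3 h4.symm
          linarith
        have h6 := lt_of_mul_lt_mul_left h5 hpm.le
        have h7 : -r + 1 ≤ k := h6
        nlinarith
      obtain ⟨z, hz, hzG, hzT⟩ := ih (r - 1) a ha hG' (by linarith) (by linarith)
      exact ⟨z, hz, hzG.mono (by linarith), hzT⟩

/-- Reduction of an Artin-Schreier class along a totally ramified step. -/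
theorem Stp.reduce (hp : p.Prime) [CharP L p] (h : Stp p w F M m b y) {r : ℤ} {a : L}
    (ha : a ∈ F) (haE : w.E (-(p * m * r)) a) (hr : ¬ (p : ℤ) ∣ r) (hbr : b < r) :
    ∃ z ∈ M, w.E (-(m * (b + p * (r - b)))) (a - (z ^ p - z)) := by
  have hp2 : (2 : ℤ) ≤ p := by exact_mod_cast hp.two_le
  have hchar : ∀ x z : L, (x + z) ^ p = x ^ p + z ^ p := by
    have := Fact.mk hp
    intro x z
    exact add_pow_char x z p
  have hmpos := h.mpos
  have hpm := h.lev.pos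
  obtain ⟨s, g, k, hg, hgE, hrs, hG'⟩ := h.leading hp ha haE
  have hs : ¬ p ∣ s := by
    rintro ⟨q, rfl⟩
    exact hr ⟨q * b - k, by rw [hrs]; push_cast; ring⟩
  have hE := h.lead_E hp s hs hgE
  rw [← hrs] at hE
  set T : ℤ := -(p * m * r) + (p - 1) * m * b with hT
  obtain ⟨z, hz, hzG, hzT⟩ := h.approx hp (T + 1) (T + 1 + p * m * (r - 1)).toNat (r - 1)
    (a - (y ^ p - y) ^ s * g ^ p)
    (sub_mem ha (mul_mem (pow_mem h.fmem s) (pow_mem hg p))) (hG'.mono (by linarith))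
    (by linarith) (by
      have h1 := Int.self_le_toNat (T + 1 + p * m * (r - 1))
      have h2 : (0 : ℤ) ≤ ((T + 1 + p * m * (r - 1)).toNat : ℤ) := by positivity
      have h3 : (1 : ℤ) ≤ p * m := hpm
      nlinarith)
  refine ⟨y ^ s * g + z, add_mem (mul_mem (pow_mem h.ymem s) (h.le hg)) hz, ?_⟩
  have hzz : w.G (-(m * r)) (y ^ s * g + z) := by
    refine DVal.G.add ?_ (hzG.mono (by linarith))
    exact ((h.yE.pow s).mul hgE).G.mono (le_of_eq (by rw [hrs]; ring))
  have hlt : T + 1 ≤ -(m * r) := by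
    have : 0 < m * ((p - 1) * (r - b)) := mul_pos hmpos (mul_pos (by linarith) (by linarith))
    have e : -(m * r) - T = m * ((p - 1) * (r - b)) := by rw [hT]; ring
    omega
  have := (hE.add_G hzT).add_G (hzz.mono hlt)
  have e : (y ^ p - y) ^ s * g ^ p - (y ^ s * g) ^ p +
        (a - (y ^ p - y) ^ s * g ^ p - z ^ p) + (y ^ s * g + z) =
      a - ((y ^ s * g + z) ^ p - (y ^ s * g + z)) := by
    rw [hchar]; ring
  rw [e] at this
  exact this.congr (by rw [hT]; ring)

/-- `σ` moves elements of `F` by exactly `B`. -/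
def Act (p : ℕ) (w : DVal L) (F : IntermediateField K L) (m B : ℤ) (σ : L ≃ₐ[K] L) : Prop :=
  ∀ x ∈ F, x ≠ 0 → w.G (w.v x + m * B) (σ x - x) ∧
    (¬ ((p : ℤ) * m ∣ w.v x) → w.E (w.v x + m * B) (σ x - x))

theorem Stp.act_aux (hp : p.Prime) [CharP L p] (h : Stp p w F M m b y) {B : ℤ} (hB : 0 < B)
    (σ : L ≃ₐ[K] L) (hinv : ∀ x : L, w.v (σ x) = w.v x)
    (hF : ∀ x ∈ F, x ≠ 0 → w.G (w.v x + p * m * B) (σ x - x))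
    (hy : w.E (m * (B - b)) (σ y - y)) : Act p w M m B σ := by
  have hp2 : (2 : ℤ) ≤ p := by exact_mod_cast hp.two_le
  have hmpos := h.mpos
  have hmB : 0 < m * B := mul_pos hmpos hB
  have hlt : -(m * b) < m * (B - b) := by linarith
  -- single terms
  have hσy : σ y = y + (σ y - y) := by ring
  have hexp : ∀ (c : L) (s : ℕ), σ (c * y ^ s) - c * y ^ s =
      c * ((y + (σ y - y)) ^ s - y ^ s) + (σ c - c) * σ y ^ s := by
    intro c s
    rw [map_mul, map_pow, add_sub_cancel]; ring
  have hσyE : w.E (-(m * b)) (σ y) :=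
    ⟨(map_ne_zero σ).2 h.yE.1, by rw [hinv]; exact h.yE.2⟩
  have hsec : ∀ (c : L) (s : ℕ), c ∈ F → c ≠ 0 →
      w.G (w.v c + s * -(m * b) + m * B + 1) ((σ c - c) * σ y ^ s) := by
    intro c s hc hc0
    exact ((hF c hc hc0).mul (hσyE.pow s).G).mono (by nlinarith)
  have htG : ∀ (c : L) (s : ℕ), c ∈ F → c ≠ 0 →
      w.G (w.v c + s * -(m * b) + m * B) (σ (c * y ^ s) - c * y ^ s) := by
    intro c s hc hc0
    rw [hexp]
    refine DVal.G.add ?_ ((hsec c s hc hc0).mono (by omega))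
    exact ((DVal.E.of_ne (w := w) hc0).G.mul (DVal.pow_sub_G h.yE hy hlt s)).mono (by linarith)
  have htE : ∀ (c : L) (s : ℕ), c ∈ F → c ≠ 0 → ¬ p ∣ s →
      w.E (w.v c + s * -(m * b) + m * B) (σ (c * y ^ s) - c * y ^ s) := by
    intro c s hc hc0 hs
    rw [hexp]
    refine DVal.E.add_G ?_ (hsec c s hc hc0)
    exact ((DVal.E.of_ne (w := w) hc0).mul (DVal.pow_sub_E p hp h.yE hy hlt s hs)).congr (by ring)
  intro x hx hx0
  obtain ⟨c, hc, hsum, s0, hs0, hc0, hv, hmin⟩ := h.min hp hx hx0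
  have hv' : w.v x = w.v (c s0) + s0 * -(m * b) := by
    rw [hv]; exact ((DVal.E.of_ne (w := w) hc0).mul (h.yE.pow s0)).2
  have hsum' : σ x - x = ∑ s ∈ Finset.range p, (σ (c s * y ^ s) - c s * y ^ s) := by
    rw [Finset.sum_sub_distrib, ← map_sum, ← hsum]
  have hother : ∀ s ∈ Finset.range p, s ≠ s0 →
      w.G (w.v x + m * B + 1) (σ (c s * y ^ s) - c s * y ^ s) := by
    intro s hs hss
    by_cases hcs : c s = 0
    · left; simp [hcs]
    have h1 := (hmin s (Finset.mem_range.1 hs) hss).le (mul_ne_zero hcs (pow_ne_zero _ h.yE.1))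
    rw [((DVal.E.of_ne (w := w) hcs).mul (h.yE.pow s)).2] at h1
    exact (htG (c s) s (hc s) hcs).mono (by linarith)
  constructor
  · rw [hsum']
    refine DVal.G.sum _ _ ?_
    intro s hs
    by_cases hss : s = s0
    · subst hss
      exact (htG _ _ (hc s) hc0).mono (by linarith)
    · exact (hother s hs hss).mono (by omega)
  · intro hnd
    rw [hsum']
    refine DVal.E.sum _ _ s0 (Finset.mem_range.2 hs0) ?_ hother
    refine (htE _ _ (hc s0) hc0 ?_).congr (by linarith)
    rintro ⟨q, hq⟩
    apply hnd
    obtain ⟨k, hk⟩ := h.lev.dvd _ (hc s0) hc0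
    refine ⟨k - q * b, ?_⟩
    rw [hv', hk, hq]; push_cast; ring

/-- start: σ trivial on `F`, nontrivial on `y`. -/
theorem Stp.act_start (hp : p.Prime) [CharP L p] (h : Stp p w F M m b y)
    (σ : L ≃ₐ[K] L) (hinv : ∀ x : L, w.v (σ x) = w.v x)
    (hF : ∀ x ∈ F, σ x = x) (hy : σ y ≠ y) : Act p w M m b σ := by
  have := Fact.mk hp
  refine h.act_aux hp h.bpos σ hinv ?_ ?_
  · intro x hx _
    left; rw [hF x hx, sub_self]
  · have h1 := hF _ h.fmem
    rw [sub_self, mul_zero]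
    refine DVal.E.of_frob hp (sub_ne_zero.2 hy) ?_
    rw [sub_pow_char]
    rw [map_sub, map_pow] at h1
    linear_combination h1

/-- step: action on `F` by `B < b` extends to `M`. -/
theorem Stp.act_step (hp : p.Prime) [CharP L p] (h : Stp p w F M m b y) {B : ℤ} (hB : 0 < B)
    (hBb : B < b) (σ : L ≃ₐ[K] L) (hinv : ∀ x : L, w.v (σ x) = w.v x)
    (hF : Act p w F (p * m) B σ) : Act p w M m B σ := by
  have := Fact.mk hp
  have hp0 : (0 : ℤ) < p := by exact_mod_cast hp.pos
  refine h.act_aux hp hB σ hinv (fun x hx hx0 => (hF x hx hx0).1) ?_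
  have hfE := h.fE hp
  have h1 := (hF _ h.fmem hfE.1).2 (by
    rw [hfE.2]
    rintro ⟨k, hk⟩
    apply h.ndvd
    refine ⟨-k, ?_⟩
    have : (p * m) * b = (p * m) * (p * -k) := by linarith
    exact mul_left_cancel₀ h.lev.pos.ne' this)
  rw [hfE.2] at h1
  obtain ⟨k, hk, hpk, -⟩ := DVal.AS_root (z := σ y - y) hp (by
    have := mul_pos h.lev.pos (sub_pos.2 hBb)
    linarith) (by rw [sub_pow_char, map_sub, map_pow]; ring) h1
  refine hk.congr (mul_left_cancel₀ hp0.ne' ?_)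
  rw [hpk]; ring

end levels


section tower
variable {K L : Type*} [Field K] [Field L] [Algebra K L]

theorem alpha_mem_tower (α : ℕ → L) {i j : ℕ} (h1 : 1 ≤ j) (h2 : j ≤ i) :
    α j ∈ towerField K α i :=
  IntermediateField.subset_adjoin K _ ⟨j, h1, h2, rfl⟩

theorem tower_mono (α : ℕ → L) {i j : ℕ} (h : i ≤ j) : towerField K α i ≤ towerField K α j := by
  refine IntermediateField.adjoin_le_iff.2 ?_
  rintro x ⟨k, h1, h2, rfl⟩
  exact alpha_mem_tower α h1 (h2.trans h)

open Polynomial in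
theorem tower_dec {p : ℕ} (hp : p.Prime) (α : ℕ → L) (i : ℕ) (y : L)
    (hf : y ^ p - y ∈ towerField K α i) (hy : α (i + 1) - y ∈ towerField K α i) :
    ∀ x ∈ towerField K α (i + 1), ∃ c : ℕ → L, (∀ s, c s ∈ towerField K α i) ∧
      x = ∑ s ∈ Finset.range p, c s * y ^ s := by
  set F := towerField K α i with hF
  have hle : towerField K α (i + 1) ≤ (IntermediateField.adjoin F {y}).restrictScalars K := by
    refine IntermediateField.adjoin_le_iff.2 ?_
    rintro x ⟨k, h1, h2, rfl⟩
    have hFm : ∀ z ∈ F, z ∈ IntermediateField.adjoin F {y} := fun z hz =>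
      (IntermediateField.adjoin F {y}).algebraMap_mem (⟨z, hz⟩ : F)
    have hym : y ∈ IntermediateField.adjoin F {y} := IntermediateField.mem_adjoin_simple_self F y
    change α k ∈ IntermediateField.adjoin F {y}
    rcases Nat.lt_or_ge i k with hk | hk
    · have : k = i + 1 := by omega
      subst this
      have := add_mem (hFm _ hy) hym
      rwa [sub_add_cancel] at this
    · exact hFm _ (alpha_mem_tower α h1 hk)
  intro x hx
  have hx' : x ∈ IntermediateField.adjoin F {y} := hle hx
  set Q : F[X] := X ^ p - (X + C ⟨y ^ p - y, hf⟩) with hQ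
  have hQm : Q.Monic := by
    refine monic_X_pow_sub ?_
    rw [degree_X_add_C]
    exact_mod_cast hp.one_lt
  have hdeg : Q.natDegree = p := by
    rw [hQ]
    rw [natDegree_sub_eq_left_of_natDegree_lt, natDegree_X_pow]
    rw [natDegree_X_add_C, natDegree_X_pow]; exact hp.one_lt
  have hroot : aeval y Q = 0 := by
    simp [hQ, IntermediateField.algebraMap_apply]
  have hIntg : IsIntegral F y := ⟨Q, hQm, hroot⟩
  rw [← IntermediateField.mem_toSubalgebra,
    IntermediateField.adjoin_simple_toSubalgebra_of_isAlgebraic hIntg.isAlgebraic,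
    Algebra.adjoin_singleton_eq_range_aeval] at hx'
  obtain ⟨q, hq⟩ := hx'
  have hq' : aeval y q = x := hq
  refine ⟨fun s => ((q %ₘ Q).coeff s : L), fun s => ((q %ₘ Q).coeff s).2, ?_⟩
  have h1 : aeval y (q %ₘ Q) = x := by
    rw [← hq']
    have := congrArg (aeval y) (modByMonic_add_div q Q)
    rw [map_add, map_mul, hroot, zero_mul, add_zero] at this
    exact this
  rw [← h1, aeval_eq_sum_range' (n := p)]
  · rfl
  · rw [← hdeg]
    refine natDegree_modByMonic_lt q hQm ?_
    intro h
    rw [h] at hdeg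
    simp at hdeg
    exact hp.ne_zero hdeg.symm

/-- data of one step of the tower -/
def TStep (p : ℕ) (w : DVal L) (α : ℕ → L) (e : ℤ) (u b : ℕ → ℤ) (j : ℕ) : Prop :=
  (∃ m y, m * (p : ℤ) ^ (j + 1) = e ∧
    Stp p w (towerField K α j) (towerField K α (j + 1)) m (b (j + 1)) y ∧
    α (j + 1) - y ∈ towerField K α j) ∧
  ∃ k, w.E k (α (j + 1)) ∧ (p : ℤ) * k = -(e * u (j + 1))

theorem tower_steps (p n : ℕ) (hp : p.Prime) [CharP L p] (w : DVal L) (e : ℤ)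
    (α d : ℕ → L) (a : ℕ → K) (u b : ℕ → ℤ) (hu0 : u 0 = 0) (hb0 : b 0 = 0)
    (hrec : ∀ i < n, b (i + 1) = b i + (p : ℤ) ^ i * (u (i + 1) - u i))
    (humono : ∀ i j, i < j → j ≤ n → u i < u j)
    (hund : ∀ i, 1 ≤ i → i ≤ n → ¬ (p : ℤ) ∣ u i)
    (hbnd : ∀ i, 1 ≤ i → i ≤ n → ¬ (p : ℤ) ∣ b i)
    (hbpos : ∀ i, 1 ≤ i → i ≤ n → 0 < b i)
    (hbu : ∀ i < n, b (i + 1) ≤ (p : ℤ) ^ i * u (i + 1))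
    (hlev0 : Lev p w (towerField K α 0) e)
    (haE : ∀ i, 1 ≤ i → i ≤ n → w.E (-(e * u i)) (algebraMap K L (a i)))
    (hdmem : ∀ i < n, d (i + 1) ∈ towerField K α i)
    (hα : ∀ i, 1 ≤ i → i ≤ n → α i ^ p - α i = d i + algebraMap K L (a i))
    (hdG : ∀ i < n, (∀ j < i, ∃ k, w.E k (α (j + 1)) ∧ (p : ℤ) * k = -(e * u (j + 1))) →
      ∀ m : ℤ, 0 < m → m * (p : ℤ) ^ i = e → w.G (-(m * b (i + 1)) + 1) (d (i + 1))) :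
    ∀ i < n, TStep (K := K) p w α e u b i := by
  have hFact := Fact.mk hp
  have hp0 : (0 : ℤ) < p := by exact_mod_cast hp.pos
  intro i
  induction i using Nat.strong_induction_on with
  | _ i ih =>
  intro hi
  have hred : ∀ j ≤ i, ∃ m, m * (p : ℤ) ^ j = e ∧ Lev p w (towerField K α j) m ∧
      ∃ c ∈ towerField K α j, w.E (-(m * (b j + (p : ℤ) ^ j * (u (i + 1) - u j))))
        (algebraMap K L (a (i + 1)) - (c ^ p - c)) := by
    intro j
    induction j with
    | zero =>
      intro _
      refine ⟨e, by simp, hlev0, 0, zero_mem _, ?_⟩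
      rw [zero_pow hp.ne_zero, sub_zero, sub_zero]
      exact (haE (i + 1) (by omega) (by omega)).congr (by rw [hu0, hb0]; ring)
    | succ j ihj =>
      intro hj
      obtain ⟨m, hm, hlev, c, hc, hcE⟩ := ihj (by omega)
      obtain ⟨⟨m', y, hm', hS, -⟩, -⟩ := ih j (by omega) (by omega)
      have hmm : m = p * m' := by
        have : m * (p : ℤ) ^ j = (p * m') * (p : ℤ) ^ j := by rw [hm, ← hm']; ring
        exact mul_right_cancel₀ (pow_ne_zero _ hp0.ne') this
      subst hmm
      have hr := hrec j (by omega)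
      obtain ⟨z, hz, hzE⟩ := hS.reduce hp (r := b j + (p : ℤ) ^ j * (u (i + 1) - u j))
        (sub_mem ((towerField K α j).algebraMap_mem _) (sub_mem (pow_mem hc p) hc)) hcE
        (by
          rcases j with _ | j
          · rw [hb0, hu0]; simpa using hund (i + 1) (by omega) (by omega)
          · intro h
            refine hbnd (j + 1) (by omega) (by omega) ((dvd_add_left ?_).1 h)
            exact (dvd_pow_self _ (by omega)).mul_right _)
        (by
          rw [hr]
          have h1 := humono (j + 1) (i + 1) (by omega) (by omega)
          have h2 : (0 : ℤ) < (p : ℤ) ^ j := by positivity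
          nlinarith)
      refine ⟨m', hm', hS.lev' hp, c + z, add_mem (hS.le hc) hz, ?_⟩
      have e1 : algebraMap K L (a (i + 1)) - ((c + z) ^ p - (c + z)) =
          algebraMap K L (a (i + 1)) - (c ^ p - c) - (z ^ p - z) := by
        rw [add_pow_char]; ring
      rw [e1]
      exact hzE.congr (by rw [hr]; ring)
  obtain ⟨m, hm, hlev, c, hc, hcE⟩ := hred i le_rfl
  have hd := hdG i hi (fun j hj => (ih j hj (by omega)).2) m hlev.pos hm
  have hbb : b i + (p : ℤ) ^ i * (u (i + 1) - u i) = b (i + 1) := (hrec i hi).symm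
  rw [hbb] at hcE
  have hαi := hα (i + 1) (by omega) (by omega)
  have hyeq : (α (i + 1) - c) ^ p - (α (i + 1) - c) =
      algebraMap K L (a (i + 1)) - (c ^ p - c) + d (i + 1) := by
    rw [sub_pow_char]; linear_combination hαi
  have hbp := hbpos (i + 1) (by omega) (by omega)
  have hmb : 0 < m * b (i + 1) := mul_pos hlev.pos hbp
  constructor
  · obtain ⟨k, hk, hpk, -⟩ := DVal.AS_root hp (by linarith) hyeq (hcE.add_G hd)
    have hpm : (p : ℤ) ∣ m := by
      have h1 : (p : ℤ) ∣ m * b (i + 1) := ⟨-k, by linarith⟩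
      exact (Int.Prime.dvd_mul' hp h1).resolve_right (hbnd (i + 1) (by omega) (by omega))
    obtain ⟨m', rfl⟩ := hpm
    have hk' : k = -(m' * b (i + 1)) := mul_left_cancel₀ hp0.ne' (by rw [hpk]; ring)
    have hfm : (α (i + 1) - c) ^ p - (α (i + 1) - c) ∈ towerField K α i := by
      rw [hyeq]
      exact add_mem (sub_mem ((towerField K α i).algebraMap_mem _) (sub_mem (pow_mem hc p) hc))
        (hdmem i hi)
    have hsub : α (i + 1) - (α (i + 1) - c) ∈ towerField K α i := by
      rw [sub_sub_cancel]; exact hc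
    refine ⟨m', α (i + 1) - c, by rw [← hm]; ring, ?_, hsub⟩
    exact {
      lev := hlev
      le := tower_mono α (by omega)
      ymem := sub_mem (alpha_mem_tower α (by omega) le_rfl) (tower_mono α (by omega) hc)
      yE := hk.congr hk'
      fmem := hfm
      bpos := hbp
      ndvd := hbnd (i + 1) (by omega) (by omega)
      dec := tower_dec hp α i _ hfm hsub }
  · have hle : m * b (i + 1) ≤ e * u (i + 1) := by
      have := mul_le_mul_of_nonneg_left (hbu i hi) hlev.pos.le
      rw [← hm]; linarith
    obtain ⟨k, hk, hpk, -⟩ := DVal.AS_root hp (by linarith) (hαi.trans (add_comm _ _))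
      ((haE (i + 1) (by omega) (by omega)).add_G (hd.mono (by linarith)))
    exact ⟨k, hk, hpk⟩

/-- Ramification of the tower: `σ` fixing `K_i` but not `α_{i+1}`. -/
theorem tower_act (p n : ℕ) (hp : p.Prime) [CharP L p] (w : DVal L) (e : ℤ)
    (α : ℕ → L) (u b : ℕ → ℤ)
    (hbpos : ∀ i, 1 ≤ i → i ≤ n → 0 < b i)
    (hbmono : ∀ i j, i < j → j ≤ n → b i < b j)
    (hst : ∀ i < n, TStep (K := K) p w α e u b i)
    (σ : L ≃ₐ[K] L) (hinv : ∀ x : L, w.v (σ x) = w.v x) (i : ℕ)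
    (hfix : ∀ x ∈ towerField K α i, σ x = x) (hne : σ (α (i + 1)) ≠ α (i + 1)) :
    ∀ j, i < j → j ≤ n → ∃ m, m * (p : ℤ) ^ j = e ∧ Act p w (towerField K α j) m (b (i + 1)) σ := by
  have hp0 : (0 : ℤ) < p := by exact_mod_cast hp.pos
  intro j hij
  induction j, hij using Nat.le_induction with
  | base =>
    intro hn
    obtain ⟨⟨m', y, hm', hS, hy⟩, -⟩ := hst i (by omega)
    refine ⟨m', hm', hS.act_start hp σ hinv hfix ?_⟩
    intro h
    apply hne
    have := hfix _ hy
    rw [map_sub, h] at this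
    exact sub_left_injective this
  | succ j hij ih =>
    intro hn
    obtain ⟨m, hm, hA⟩ := ih (by omega)
    obtain ⟨⟨m', y, hm', hS, hy⟩, -⟩ := hst j (by omega)
    have hmm : m = p * m' := by
      have : m * (p : ℤ) ^ j = (p * m') * (p : ℤ) ^ j := by rw [hm, ← hm']; ring
      exact mul_right_cancel₀ (pow_ne_zero _ hp0.ne') this
    subst hmm
    exact ⟨m', hm', hS.act_step hp (hbpos (i + 1) (by omega) (by omega))
      (hbmono (i + 1) (j + 1) (by omega) hn) σ hinv hA⟩

end tower


section galois
open MvPolynomial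

variable {K L : Type*} [Field K] [Field L] [Algebra K L]

/-- the structure map `F_p → L` -/
noncomputable def phi (p : ℕ) (K L : Type*) [Field K] [Field L] [Algebra K L] [CharP K p] :
    ZMod p →+* L :=
  (algebraMap K L).comp (ZMod.castHom (dvd_refl p) K)

/-- evaluation `S_i → L` -/
noncomputable def theta (p : ℕ) (K : Type*) {L : Type*} [Field K] [Field L] [Algebra K L]
    [CharP K p] (α : ℕ → L) (i : ℕ) : MvPolynomial (Fin i) (ZMod p) →+* L :=
  eval₂Hom (phi p K L) (fun k : Fin i => α ((k : ℕ) + 1))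

theorem theta_X (p : ℕ) [CharP K p] (α : ℕ → L) {i : ℕ} (k : Fin i) :
    theta p K α i (X k) = α ((k : ℕ) + 1) := by
  simp [theta]

theorem theta_rename (p : ℕ) [CharP K p] (α : ℕ → L) {i j : ℕ} (h : i ≤ j)
    (q : MvPolynomial (Fin i) (ZMod p)) :
    theta p K α j (rename (Fin.castLE h) q) = theta p K α i q := by
  simp only [theta, coe_eval₂Hom, eval₂_rename]
  rfl

theorem ringHom_eq_theta (p : ℕ) [CharP K p] (β : ℕ → L) {i : ℕ}
    (ψ : MvPolynomial (Fin i) (ZMod p) →+* L) (h : ∀ k : Fin i, ψ (X k) = β ((k : ℕ) + 1)) :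
    ψ = theta p K β i := by
  refine MvPolynomial.ringHom_ext' (Subsingleton.elim _ _) ?_
  intro k
  rw [h, theta_X]

theorem theta_Xelt (p : ℕ) [CharP K p] (D : (j : ℕ) → MvPolynomial (Fin (j - 1)) (ZMod p))
    (β : ℕ → L) {i j : ℕ} (h1 : 1 ≤ j) (h : j - 1 < i) :
    theta p K β i (Xelt p D i j h) = β j ^ p - β j - theta p K β (j - 1) (D j) := by
  rw [Xelt, map_sub, map_sub, map_pow, theta_X, theta_rename]
  simp only
  rw [Nat.sub_add_cancel h1]

/-- solutions of the tower equations -/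
def Sol (p : ℕ) (K : Type*) {L : Type*} [Field K] [Field L] [Algebra K L] [CharP K p]
    (D : (j : ℕ) → MvPolynomial (Fin (j - 1)) (ZMod p)) (a : ℕ → K) (i : ℕ) (β : ℕ → L) : Prop :=
  ∀ j, 1 ≤ j → j ≤ i → β j ^ p - β j = theta p K β (j - 1) (D j) + algebraMap K L (a j)

theorem theta_congr (p : ℕ) [CharP K p] {β γ : ℕ → L} {i : ℕ}
    (h : ∀ j, 1 ≤ j → j ≤ i → β j = γ j) : theta p K β i = theta p K γ i := by
  refine ringHom_eq_theta p γ _ ?_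
  intro k
  rw [theta_X]
  exact h _ (by omega) (by omega)

theorem sol_count (p : ℕ) (hp : p.Prime) [CharP K p]
    (D : (j : ℕ) → MvPolynomial (Fin (j - 1)) (ZMod p)) (a : ℕ → K) (i : ℕ) :
    ∃ T : Finset (ℕ → L), T.card ≤ p ^ i ∧
      ∀ β : ℕ → L, Sol p K D a i β → ∃ γ ∈ T, ∀ j, 1 ≤ j → j ≤ i → β j = γ j := by
  classical
  induction i with
  | zero =>
    refine ⟨{fun _ => 0}, by simp, ?_⟩
    intro β _
    exact ⟨_, Finset.mem_singleton_self _, fun j h1 h2 => by omega⟩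
  | succ i ih =>
    obtain ⟨T, hT, hcov⟩ := ih
    let P : (ℕ → L) → Polynomial L := fun γ => Polynomial.X ^ p -
      (Polynomial.X + Polynomial.C (theta p K γ i (D (i + 1)) + algebraMap K L (a (i + 1))))
    have hPm : ∀ γ, (P γ).Monic := by
      intro γ
      refine Polynomial.monic_X_pow_sub ?_
      rw [Polynomial.degree_X_add_C]
      exact_mod_cast hp.one_lt
    have hdeg : ∀ γ, (P γ).natDegree = p := by
      intro γ
      simp only [P]
      rw [Polynomial.natDegree_sub_eq_left_of_natDegree_lt, Polynomial.natDegree_X_pow]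
      rw [Polynomial.natDegree_X_add_C, Polynomial.natDegree_X_pow]; exact hp.one_lt
    refine ⟨T.biUnion fun γ => (P γ).roots.toFinset.image fun x => Function.update γ (i + 1) x,
      ?_, ?_⟩
    · refine (Finset.card_biUnion_le_card_mul _ _ p ?_).trans ?_
      · intro γ _
        refine Finset.card_image_le.trans ((Multiset.toFinset_card_le _).trans ?_)
        exact (Polynomial.card_roots' _).trans (hdeg γ).le
      · rw [pow_succ]
        exact Nat.mul_le_mul_right _ hT
    · intro β hβ
      obtain ⟨γ, hγ, hag⟩ := hcov β (fun j h1 h2 => hβ j h1 (by omega))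
      refine ⟨Function.update γ (i + 1) (β (i + 1)), ?_, ?_⟩
      · rw [Finset.mem_biUnion]
        refine ⟨γ, hγ, Finset.mem_image_of_mem _ ?_⟩
        rw [Multiset.mem_toFinset, Polynomial.mem_roots (hPm γ).ne_zero]
        have h1 := hβ (i + 1) (by omega) le_rfl
        have h2 : theta p K β i = theta p K γ i := theta_congr p hag
        change _ = theta p K β i _ + _ at h1
        rw [h2] at h1
        simp only [P, Polynomial.IsRoot, Polynomial.eval_sub, Polynomial.eval_pow,
          Polynomial.eval_X, Polynomial.eval_add, Polynomial.eval_C]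
        linear_combination h1
      · intro j h1 h2
        by_cases hj : j = i + 1
        · subst hj; simp
        · rw [Function.update_of_ne hj]
          exact hag j h1 (by omega)

theorem tower_ext (α : ℕ → L) (i : ℕ) (σ : L ≃ₐ[K] L) :
    σ ∈ (towerField K α i).fixingSubgroup ↔ ∀ j, 1 ≤ j → j ≤ i → σ (α j) = α j := by
  rw [IntermediateField.mem_fixingSubgroup_iff]
  constructor
  · intro h j h1 h2
    exact h _ (alpha_mem_tower α h1 h2)
  · intro h x hx
    have hle : towerField K α i ≤ IntermediateField.fixedField (Subgroup.zpowers σ) := by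
      refine IntermediateField.adjoin_le_iff.2 ?_
      rintro x ⟨j, h1, h2, rfl⟩
      rw [SetLike.mem_coe, IntermediateField.mem_fixedField_iff]
      intro f hf
      have : Subgroup.zpowers σ ≤ MulAction.stabilizer (L ≃ₐ[K] L) (α j) := by
        rw [Subgroup.zpowers_le]
        exact h j h1 h2
      exact this hf
    exact (IntermediateField.mem_fixedField_iff _ _).1 (hle hx) σ (Subgroup.mem_zpowers σ)

section main
variable (p n : ℕ) (hp : p.Prime) [CharP K p]
    {G : Type*} [Group G]
    (Gser : ℕ → Subgroup G) [∀ j, (Gser j).Normal]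
    (D : (j : ℕ) → MvPolynomial (Fin (j - 1)) (ZMod p))
    (ρ : (i : ℕ) → (G ⧸ Gser i) →* RingAut (MvPolynomial (Fin i) (ZMod p)))

theorem theta_chain
    (hcompat : ∀ i, 1 ≤ i → i ≤ n → ∀ g : G, ∀ q : MvPolynomial (Fin (i - 1)) (ZMod p),
        ρ i (QuotientGroup.mk g) (rename (Fin.castLE (Nat.sub_le i 1)) q) =
          rename (Fin.castLE (Nat.sub_le i 1)) (ρ (i - 1) (QuotientGroup.mk g) q))
    (α : ℕ → L) (g : G) {i t : ℕ} (h : i ≤ t) (ht : t ≤ n) (q : MvPolynomial (Fin i) (ZMod p)) :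
    theta p K α t (ρ t (QuotientGroup.mk g) (rename (Fin.castLE h) q)) =
      theta p K α i (ρ i (QuotientGroup.mk g) q) := by
  induction t, h using Nat.le_induction with
  | base => simp
  | succ t h ih =>
    have e : rename (Fin.castLE (show i ≤ t + 1 by omega)) q =
        rename (Fin.castLE (Nat.sub_le (t + 1) 1)) (rename (Fin.castLE h) q) := by
      rw [rename_rename]; rfl
    rw [e]
    erw [hcompat (t + 1) (by omega) ht g (rename (Fin.castLE h) q)]
    erw [theta_rename p α (show t ≤ t + 1 by omega)]
    exact ih (by omega)

theorem theta_free {i : ℕ}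
    (hfree : ∀ M : Ideal (MvPolynomial (Fin i) (ZMod p)), M.IsMaximal →
        ∀ g : G ⧸ Gser i, g ≠ 1 →
          ∃ s : MvPolynomial (Fin i) (ZMod p), ρ i g s - s ∉ M)
    (α : ℕ → L) (g : G ⧸ Gser i) (h : ∀ k : Fin i, theta p K α i (ρ i g (X k)) = α (k + 1)) :
    g = 1 := by
  by_contra hg
  obtain ⟨M, hM, hle⟩ := Ideal.exists_le_maximal (RingHom.ker (theta p K α i))
    (RingHom.ker_ne_top _)
  obtain ⟨s, hs⟩ := hfree M hM g hg
  apply hs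
  apply hle
  rw [RingHom.mem_ker, map_sub, sub_eq_zero]
  have := ringHom_eq_theta (K := K) p α ((theta p K α i).comp ((ρ i g).toRingHom)) h
  exact DFunLike.congr_fun this s

/-- the value at `1 ≤ j ≤ n` of the solution attached to `g` -/
noncomputable def bet (α : ℕ → L) (g : G ⧸ Gser n) (j : ℕ) : L :=
  if h : j - 1 < n then theta p K α n (ρ n g (X ⟨j - 1, h⟩)) else 0

theorem bet_theta (α : ℕ → L) (g : G ⧸ Gser n) (q : MvPolynomial (Fin n) (ZMod p)) :
    theta p K α n (ρ n g q) = theta p K (bet (K := K) p n Gser ρ α g) n q := by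
  refine DFunLike.congr_fun (ringHom_eq_theta (K := K) p (bet (K := K) p n Gser ρ α g)
    ((theta p K α n).comp ((ρ n g).toRingHom)) ?_) q
  intro k
  simp [bet]

variable (a : ℕ → K) (α : ℕ → L)

theorem bet_sol (hinvt : ∀ q : MvPolynomial (Fin n) (ZMod p), (∀ g : G ⧸ Gser n, ρ n g q = q) ↔
      q ∈ Algebra.adjoin (ZMod p) (XeltSet p D n))
    (hα : Sol p K D a n α)
    (g : G ⧸ Gser n) : Sol p K D a n (bet (K := K) p n Gser ρ α g) := by
  intro j h1 h2
  have hX : Xelt p D n j (by omega) ∈ Algebra.adjoin (ZMod p) (XeltSet p D n) :=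
    Algebra.subset_adjoin ⟨j, h1, h2, rfl⟩
  have h3 := (hinvt _).2 hX g
  have h4 := bet_theta (K := K) p n Gser ρ α g (Xelt p D n j (by omega))
  rw [h3, theta_Xelt p D _ h1, theta_Xelt p D _ h1, hα j h1 h2] at h4
  linear_combination -h4

theorem theta_inv (hinvt : ∀ q : MvPolynomial (Fin n) (ZMod p), (∀ g : G ⧸ Gser n, ρ n g q = q) ↔
      q ∈ Algebra.adjoin (ZMod p) (XeltSet p D n))
    (hα : Sol p K D a n α)
    (q : MvPolynomial (Fin n) (ZMod p)) (hq : ∀ g : G ⧸ Gser n, ρ n g q = q) :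
    theta p K α n q ∈ (algebraMap K L).range := by
  rw [hinvt] at hq
  induction hq using Algebra.adjoin_induction with
  | mem x hx =>
    obtain ⟨j, h1, h2, rfl⟩ := hx
    rw [theta_Xelt p D _ h1, hα j h1 h2]
    exact ⟨a j, by ring⟩
  | algebraMap r =>
    rw [MvPolynomial.algebraMap_eq, theta, coe_eval₂Hom, eval₂_C]
    exact ⟨_, rfl⟩
  | add x y _ _ hx hy => rw [map_add]; exact add_mem hx hy
  | mul x y _ _ hx hy => rw [map_mul]; exact mul_mem hx hy

theorem tower_separable (hp : p.Prime) (hα : Sol p K D a n α)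
    (hgen : towerField K α n = ⊤) : Algebra.IsSeparable K L := by
  have hF := Fact.mk hp
  have : CharP L p := charP_of_injective_algebraMap (algebraMap K L).injective p
  rw [← separableClosure.eq_top_iff, eq_top_iff, ← hgen]
  have key : ∀ i ≤ n, ∀ j, 1 ≤ j → j ≤ i → α j ∈ separableClosure K L := by
    intro i
    induction i with
    | zero => intro _ j h1 h2; omega
    | succ i ih =>
      intro hi j h1 h2
      rcases Nat.lt_or_ge i j with hj | hj
      swap
      · exact ih (by omega) j h1 hj
      have : j = i + 1 := by omega
      subst this
      set S := separableClosure K L with hS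
      have hc : theta p K α i (D (i + 1)) + algebraMap K L (a (i + 1)) ∈ S := by
        refine add_mem ?_ (S.algebraMap_mem _)
        rw [theta, coe_eval₂Hom, eval₂_eq]
        refine sum_mem fun m _ => mul_mem (S.algebraMap_mem _) (prod_mem fun k _ => pow_mem ?_ _)
        exact ih (by omega) _ (by omega) (by omega)
      have heq : α (i + 1) ^ p - α (i + 1) = theta p K α i (D (i + 1)) +
        algebraMap K L (a (i + 1)) := hα (i + 1) h1 hi
      have hsep : IsSeparable S (α (i + 1)) := by
        let Q : Polynomial S := Polynomial.X ^ p - Polynomial.X - Polynomial.C ⟨_, hc⟩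
        have hQs : Q.Separable := by
          have : CharP S p := charP_of_injective_algebraMap (algebraMap K S).injective p
          rw [Polynomial.separable_def]
          have : Polynomial.derivative Q = -1 := by
            simp [Q, Polynomial.derivative_X_pow]
          rw [this]
          exact isCoprime_one_right.neg_right
        refine hQs.of_dvd (minpoly.dvd _ _ ?_)
        simp only [Q, map_sub, map_pow, Polynomial.aeval_X, Polynomial.aeval_C,
          IntermediateField.algebraMap_apply]
        rw [heq, sub_self]
      have h3 := mem_separableClosure_iff.2 hsep
      rw [separableClosure.separableClosure_eq_bot, IntermediateField.mem_bot] at h3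
      obtain ⟨z, hz⟩ := h3
      rw [← hz]
      exact z.2
  refine IntermediateField.adjoin_le_iff.2 ?_
  rintro x ⟨j, h1, h2, rfl⟩
  exact key n le_rfl j h1 h2

theorem tower_normal [Finite G] (hp : p.Prime) (hinvt : ∀ q : MvPolynomial (Fin n) (ZMod p), (∀ g : G ⧸ Gser n, ρ n g q = q) ↔
      q ∈ Algebra.adjoin (ZMod p) (XeltSet p D n))
    (hα : Sol p K D a n α)
    (hgen : towerField K α n = ⊤) : Normal K L := by
  classical
  have := Fintype.ofFinite (G ⧸ Gser n)
  have hsepi : Algebra.IsSeparable K L := tower_separable p n D a α hp hα hgen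
  have halg : Algebra.IsAlgebraic K L := inferInstance
  refine ⟨?_⟩
  intro x
  have hx : x ∈ IntermediateField.adjoin K (towerSet α n) := by
    have : x ∈ towerField K α n := by rw [hgen]; trivial
    exact this
  refine IntermediateField.splits_of_mem_adjoin K L ?_ hx
  rintro y ⟨j, h1, h2, rfl⟩
  refine ⟨(halg.isAlgebraic _).isIntegral, ?_⟩
  have hj : j - 1 < n := by omega
  let P : Polynomial (MvPolynomial (Fin n) (ZMod p)) :=
    ∏ g : G ⧸ Gser n, (Polynomial.X - Polynomial.C (ρ n g (X ⟨j - 1, hj⟩)))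
  have hPinv : ∀ g, P.map ((ρ n g).toRingHom) = P := by
    intro g
    simp only [P, Polynomial.map_prod, Polynomial.map_sub, Polynomial.map_X, Polynomial.map_C]
    refine Fintype.prod_equiv (Equiv.mulLeft g) _ _ ?_
    intro h
    simp only [Equiv.coe_mulLeft, map_mul]
    rfl
  have hPl : P.map (theta p K α n) ∈ Polynomial.lifts (algebraMap K L) := by
    rw [Polynomial.lifts_iff_coeff_lifts]
    intro k
    rw [Polynomial.coeff_map]
    refine theta_inv p n Gser D ρ a α hinvt hα _ ?_
    intro g
    conv_rhs => rw [← hPinv g]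
    rw [Polynomial.coeff_map]
    rfl
  obtain ⟨Q, hQ⟩ := (Polynomial.mem_lifts _).1 hPl
  have hPP : P.map (theta p K α n) =
      ∏ g : G ⧸ Gser n, (Polynomial.X - Polynomial.C (theta p K α n (ρ n g (X ⟨j - 1, hj⟩)))) := by
    simp only [P, Polynomial.map_prod, Polynomial.map_sub, Polynomial.map_X, Polynomial.map_C]
  have hP0 : P.map (theta p K α n) ≠ 0 := by
    rw [hPP, Finset.prod_ne_zero_iff]
    intro g _
    exact Polynomial.X_sub_C_ne_zero _
  have hsplit : (Q.map (algebraMap K L)).Splits := by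
    rw [hQ, hPP]
    exact Polynomial.Splits.prod fun g _ => Polynomial.Splits.X_sub_C _
  have hroot : Polynomial.aeval (α j) Q = 0 := by
    rw [Polynomial.aeval_def, ← Polynomial.eval_map, hQ, hPP, Polynomial.eval_prod]
    refine Finset.prod_eq_zero (Finset.mem_univ 1) ?_
    rw [map_one, RingAut.one_apply, theta_X]
    simp only [Polynomial.eval_sub, Polynomial.eval_X, Polynomial.eval_C]
    rw [Nat.sub_add_cancel h1, sub_self]
  refine hsplit.of_dvd ?_ (Polynomial.map_dvd _ (minpoly.dvd _ _ hroot))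
  rw [hQ]; exact hP0

end main
end galois


section galois2
open MvPolynomial

variable {K L : Type*} [Field K] [Field L] [Algebra K L]

theorem tower_findim (n : ℕ) (α : ℕ → L) (hgen : towerField K α n = ⊤)
    (halg : Algebra.IsAlgebraic K L) : FiniteDimensional K L := by
  have hfin : (towerSet α n).Finite := by
    refine ((Set.finite_Icc 1 n).image α).subset ?_
    rintro x ⟨j, h1, h2, rfl⟩
    exact ⟨j, ⟨h1, h2⟩, rfl⟩
  have := hfin.to_subtype
  have h1 : FiniteDimensional K (IntermediateField.adjoin K (towerSet α n)) :=
    IntermediateField.finiteDimensional_adjoin fun x _ => (halg.isAlgebraic x).isIntegral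
  change FiniteDimensional K (towerField K α n) at h1
  rw [hgen] at h1
  exact Module.Finite.equiv (IntermediateField.topEquiv (F := K) (E := L)).toLinearEquiv

theorem tower_galois (p n : ℕ) (hp : p.Prime) (hn : 1 ≤ n)
    {G : Type*} [Group G] [Finite G] (hG : Nat.card G = p ^ n)
    (Gser : ℕ → Subgroup G) [∀ j, (Gser j).Normal]
    (htop : Gser 0 = ⊤) (hbot : Gser n = ⊥)
    (D : (j : ℕ) → MvPolynomial (Fin (j - 1)) (ZMod p))
    [CharP K p] (a : ℕ → K) (α : ℕ → L)
    (ρ : (i : ℕ) → (G ⧸ Gser i) →* RingAut (MvPolynomial (Fin i) (ZMod p)))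
    (hinvt : ∀ q : MvPolynomial (Fin n) (ZMod p), (∀ g : G ⧸ Gser n, ρ n g q = q) ↔
          q ∈ Algebra.adjoin (ZMod p) (XeltSet p D n))
    (hfree : ∀ i, 1 ≤ i → i ≤ n → ∀ M : Ideal (MvPolynomial (Fin i) (ZMod p)), M.IsMaximal →
        ∀ g : G ⧸ Gser i, g ≠ 1 →
          ∃ s : MvPolynomial (Fin i) (ZMod p), ρ i g s - s ∉ M)
    (hcompat : ∀ i, 1 ≤ i → i ≤ n → ∀ g : G, ∀ q : MvPolynomial (Fin (i - 1)) (ZMod p),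
        ρ i (QuotientGroup.mk g) (rename (Fin.castLE (Nat.sub_le i 1)) q) =
          rename (Fin.castLE (Nat.sub_le i 1)) (ρ (i - 1) (QuotientGroup.mk g) q))
    (hα : Sol p K D a n α) (hgen : towerField K α n = ⊤)
    (hrank : FiniteDimensional K L → p ^ n ≤ Module.finrank K L) :
    IsGalois K L ∧ ∃ μ : (L ≃ₐ[K] L) ≃* G,
        ∀ i, i ≤ n →
          Subgroup.map μ.toMonoidHom (towerField K α i).fixingSubgroup = Gser i := by
  classical
  have hsep : Algebra.IsSeparable K L := tower_separable p n D a α hp hα hgen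
  have hnor : Normal K L := tower_normal p n Gser D ρ a α hp hinvt hα hgen
  have hgal : IsGalois K L := ⟨⟩
  have hfd : FiniteDimensional K L := tower_findim n α hgen inferInstance
  have hcardGal : p ^ n ≤ Nat.card (L ≃ₐ[K] L) := by
    rw [IsGalois.card_aut_eq_finrank]; exact hrank hfd
  refine ⟨hgal, ?_⟩
  have hone : ∀ {g : G}, (QuotientGroup.mk g : G ⧸ Gser n) = 1 → g = 1 := by
    intro g hg
    rw [QuotientGroup.eq_one_iff, hbot, Subgroup.mem_bot] at hg
    exact hg
  -- `Θ g = θ ∘ ρ(g)`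
  let Θ : G → MvPolynomial (Fin n) (ZMod p) →+* L := fun g =>
    (theta p K α n).comp ((ρ n (QuotientGroup.mk g)).toRingHom)
  have hΘ : ∀ g q, Θ g q = theta p K α n (ρ n (QuotientGroup.mk g) q) := fun g q => rfl
  have hΘmul : ∀ g h q, Θ (g * h) q = Θ g (ρ n (QuotientGroup.mk h) q) := by
    intro g h q
    rw [hΘ, hΘ, QuotientGroup.mk_mul, map_mul]; rfl
  have hΘone : Θ 1 = theta p K α n := by
    refine RingHom.ext fun q => ?_
    rw [hΘ, QuotientGroup.mk_one, map_one]; rfl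
  have hΘinj : ∀ g h, Θ g = Θ h → g = h := by
    intro g h hgh
    have h1 : (QuotientGroup.mk (g * h⁻¹) : G ⧸ Gser n) = 1 := by
      refine theta_free (K := K) p Gser ρ (hfree n hn le_rfl) α _ ?_
      intro k
      rw [← hΘ, hΘmul, hgh, ← hΘmul, mul_inv_cancel, hΘone, theta_X]
    have := hone h1
    rwa [mul_inv_eq_one] at this
  -- every automorphism comes from `g`
  have hex : ∀ σ : L ≃ₐ[K] L, ∃ g : G, ∀ q, σ (theta p K α n q) = Θ g q := by
    obtain ⟨T, hTc, hT⟩ := sol_count (L := L) p hp D a n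
    have hb : ∀ g : G, ∃ γ ∈ T, ∀ j, 1 ≤ j → j ≤ n →
        bet (K := K) p n Gser ρ α (QuotientGroup.mk g) j = γ j := fun g =>
      hT _ (bet_sol p n Gser D ρ a α hinvt hα _)
    choose f hfT hf using hb
    have hΘf : ∀ g, Θ g = theta p K (f g) n := by
      intro g
      rw [← theta_congr p (hf g)]
      refine RingHom.ext fun q => ?_
      rw [hΘ, bet_theta]
    have hfinj : Function.Injective f := by
      intro g h hgh
      exact hΘinj g h (by rw [hΘf, hΘf, hgh])
    have := Fintype.ofFinite G
    have himg : Finset.univ.image f = T := by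
      refine Finset.eq_of_subset_of_card_le ?_ ?_
      · intro x hx
        obtain ⟨g, -, rfl⟩ := Finset.mem_image.1 hx
        exact hfT g
      · rw [Finset.card_image_of_injective _ hfinj, Finset.card_univ, ← Nat.card_eq_fintype_card,
          hG]
        exact hTc
    intro σ
    have hcomp : ∀ i, ((σ : L →+* L)).comp (theta p K α i) = theta p K (fun j => σ (α j)) i := by
      intro i
      refine ringHom_eq_theta p _ _ ?_
      intro k
      rw [RingHom.comp_apply, theta_X]; rfl
    have hsol : Sol p K D a n (fun j => σ (α j)) := by
      intro j h1 h2
      have h3 := congrArg σ (hα j h1 h2)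
      rw [map_sub, map_pow, map_add, AlgEquiv.commutes] at h3
      rw [← hcomp]
      exact h3
    obtain ⟨γ, hγ, hag⟩ := hT _ hsol
    rw [← himg, Finset.mem_image] at hγ
    obtain ⟨g, -, rfl⟩ := hγ
    refine ⟨g, fun q => ?_⟩
    rw [hΘf, ← theta_congr p hag, ← hcomp]; rfl
  choose F hF using hex
  have hFmul : ∀ σ τ, F (σ * τ) = F σ * F τ := by
    intro σ τ
    refine hΘinj _ _ (RingHom.ext fun q => ?_)
    rw [← hF, AlgEquiv.mul_apply, hF τ, hΘ, hF σ, ← hΘmul]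
  have hval : ∀ σ j (h1 : 1 ≤ j) (h2 : j ≤ n),
      σ (α j) = Θ (F σ) (X ⟨j - 1, by omega⟩) := by
    intro σ j h1 h2
    rw [← hF, theta_X]
    simp only [Nat.sub_add_cancel h1]
  -- fixing subgroup
  have hfix : ∀ i ≤ n, ∀ σ, σ ∈ (towerField K α i).fixingSubgroup ↔ F σ ∈ Gser i := by
    intro i hi σ
    rcases Nat.eq_zero_or_pos i with rfl | hipos
    · rw [tower_ext, htop]
      simp only [Subgroup.mem_top, iff_true]
      intro j h1 h2; omega
    have hk : ∀ k : Fin i, σ (α (k + 1)) = theta p K α i (ρ i (QuotientGroup.mk (F σ)) (X k)) := by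
      intro k
      rw [← theta_chain (K := K) p n Gser ρ hcompat α (F σ) hi le_rfl, rename_X, ← hΘ, ← hF,
        theta_X]
      rfl
    rw [tower_ext, ← QuotientGroup.eq_one_iff]
    constructor
    · intro h
      refine theta_free (K := K) p Gser ρ (hfree i hipos hi) α _ ?_
      intro k
      rw [← hk]
      exact h _ (by omega) (by omega)
    · intro h j h1 h2
      have := hk ⟨j - 1, by omega⟩
      rw [h, map_one] at this
      simp only [Nat.sub_add_cancel h1] at this
      rw [this, RingAut.one_apply, theta_X]
      simp only [Nat.sub_add_cancel h1]
  let F' : (L ≃ₐ[K] L) →* G := MonoidHom.mk' F hFmul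
  have hF'inj : Function.Injective F' := by
    rw [injective_iff_map_eq_one]
    intro σ hσ
    have h1 : σ ∈ (towerField K α n).fixingSubgroup := by
      rw [hfix n le_rfl, hbot, Subgroup.mem_bot]; exact hσ
    rw [hgen, IntermediateField.fixingSubgroup_top, Subgroup.mem_bot] at h1
    exact h1
  have hbij : Function.Bijective F' := by
    have := Fintype.ofFinite G
    have := Fintype.ofFinite (L ≃ₐ[K] L)
    rw [Fintype.bijective_iff_injective_and_card]
    refine ⟨hF'inj, le_antisymm (Fintype.card_le_of_injective _ hF'inj) ?_⟩
    rw [← Nat.card_eq_fintype_card, ← Nat.card_eq_fintype_card, hG]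
    exact hcardGal
  refine ⟨MulEquiv.ofBijective F' hbij, ?_⟩
  intro i hi
  ext g
  rw [Subgroup.mem_map]
  constructor
  · rintro ⟨σ, hσ, rfl⟩
    exact (hfix i hi σ).1 hσ
  · intro hg
    obtain ⟨σ, rfl⟩ := hbij.2 g
    exact ⟨σ, (hfix i hi σ).2 hg, rfl⟩

end galois2

section herb
variable {K L : Type*} [Field K] [Field L] [Algebra K L]

theorem ram_final (p n : ℕ) (hp : p.Prime) (hn : 1 ≤ n) (vL : DVal L) (πL : L)
    (Fx : ℕ → Subgroup (L ≃ₐ[K] L)) (hF0 : Fx 0 = ⊤) (hFn : Fx n = ⊥)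
    (hanti : ∀ i j, i ≤ j → Fx j ≤ Fx i)
    (hcard : ∀ i ≤ n, Nat.card (Fx i) = p ^ (n - i))
    (u b : ℕ → ℤ) (hu0 : u 0 = 0) (hb0 : b 0 = 0)
    (hrec : ∀ i < n, b (i + 1) = b i + (p : ℤ) ^ i * (u (i + 1) - u i))
    (hbmono : ∀ i j, i < j → j ≤ n → b i < b j)
    (hram : ∀ i < n, ∀ σ, σ ∈ Fx i → σ ∉ Fx (i + 1) → ramNum K vL πL σ = b (i + 1)) :
    (∀ x : ℝ, IsUpperBreak K vL πL x ↔ ∃ i, 1 ≤ i ∧ i ≤ n ∧ x = ((u i : ℤ) : ℝ)) ∧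
    (∀ x : ℝ, IsLowerBreak K vL πL x ↔ ∃ i, 1 ≤ i ∧ i ≤ n ∧ x = ((b i : ℤ) : ℝ)) ∧
    (∀ t : ℝ, ∃ i, i ≤ n ∧ lowerSet K vL πL t = (Fx i : Set (L ≃ₐ[K] L))) ∧
    (∀ i, i ≤ n → ∃ t : ℝ, (Fx i : Set (L ≃ₐ[K] L)) = lowerSet K vL πL t) := by
  classical
  have hbmono' : ∀ i j, i ≤ j → j ≤ n → b i ≤ b j := by
    intro i j h1 h2
    rcases h1.eq_or_lt with rfl | h
    · exact le_rfl
    · exact (hbmono i j h h2).le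
  have cls : ∀ σ : L ≃ₐ[K] L, σ ≠ 1 → ∃ i < n, σ ∈ Fx i ∧ σ ∉ Fx (i + 1) := by
    intro σ hσ
    have hex : ∃ j, σ ∉ Fx j := ⟨n, by rw [hFn, Subgroup.mem_bot]; exact hσ⟩
    have hs := Nat.find_spec hex
    have hle : Nat.find hex ≤ n := Nat.find_min' hex (by rw [hFn, Subgroup.mem_bot]; exact hσ)
    have hmin := fun m => Nat.find_min hex (m := m)
    generalize Nat.find hex = j at hs hle hmin
    rcases j with _ | j
    · rw [hF0] at hs; exact absurd (Subgroup.mem_top σ) hs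
    · exact ⟨j, by omega, not_not.1 (hmin j (by omega)), hs⟩
  have hlow : ∀ i ≤ n, ∀ t : ℝ, (1 ≤ i → (b i : ℝ) < t) → (i < n → t ≤ b (i + 1)) →
      lowerSet K vL πL t = (Fx i : Set (L ≃ₐ[K] L)) := by
    intro i hi t h1 h2
    ext σ
    by_cases hσ : σ = 1
    · subst hσ
      simp [lowerSet, one_mem]
    obtain ⟨i', hi', hm, hnm⟩ := cls σ hσ
    simp only [lowerSet, Set.mem_ofPred_eq, SetLike.mem_coe, hσ, false_or, hram i' hi' σ hm hnm]
    constructor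
    · intro ht
      refine hanti i i' ?_ hm
      by_contra hlt
      push Not at hlt
      have h3 := h1 (by omega)
      have h4 : (b (i' + 1) : ℝ) ≤ b i := by exact_mod_cast hbmono' (i' + 1) i hlt hi
      linarith
    · intro hmem
      have hle : i ≤ i' := by
        by_contra hlt
        push Not at hlt
        exact hnm (hanti (i' + 1) i hlt hmem)
      have h3 := h2 (by omega)
      have h4 : (b (i + 1) : ℝ) ≤ b (i' + 1) := by
        exact_mod_cast hbmono' (i + 1) (i' + 1) (by omega) (by omega)
      linarith
  have hlowbr : ∀ x : ℝ, IsLowerBreak K vL πL x ↔ ∃ i, 1 ≤ i ∧ i ≤ n ∧ x = ((b i : ℤ) : ℝ) := by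
    intro x
    constructor
    · rintro ⟨σ, hσ, rfl⟩
      obtain ⟨i', hi', hm, hnm⟩ := cls σ hσ
      exact ⟨i' + 1, by omega, by omega, by rw [hram i' hi' σ hm hnm]⟩
    · rintro ⟨i, h1, h2, rfl⟩
      obtain ⟨i, rfl⟩ : ∃ k, i = k + 1 := ⟨i - 1, by omega⟩
      have hnle : ¬ Fx i ≤ Fx (i + 1) := by
        intro hle
        have heq := le_antisymm hle (hanti i (i + 1) (by omega))
        have h3 := hcard i (by omega)
        rw [heq, hcard (i + 1) h2] at h3
        have := Nat.pow_right_injective hp.two_le h3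
        omega
      obtain ⟨σ, hm, hnm⟩ := SetLike.not_le_iff_exists.1 hnle
      refine ⟨σ, ?_, by rw [hram i (by omega) σ hm hnm]⟩
      rintro rfl
      exact hnm (one_mem _)
  have hp0 : (0 : ℝ) < p := by exact_mod_cast hp.pos
  have hcard0 : (Nat.card ↥(lowerSet K vL πL 0) : ℝ) = (p : ℝ) ^ n := by
    rw [hlow 0 (by omega) 0 (by omega) (by
      intro _
      have := hbmono 0 1 (by omega) hn
      rw [hb0] at this
      exact_mod_cast this.le)]
    have := hcard 0 (by omega)
    rw [Nat.sub_zero] at this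
    exact_mod_cast this
  have hIntg : ∀ i ≤ n, IntervalIntegrable (fun t => (Nat.card ↥(lowerSet K vL πL t) : ℝ) /
      (Nat.card ↥(lowerSet K vL πL 0) : ℝ)) MeasureTheory.volume 0 (b i : ℝ) ∧
      hherb K vL πL (b i) = u i := by
    intro i
    induction i with
    | zero =>
      intro _
      rw [hb0, hu0]
      simp [hherb]
    | succ i ih =>
      intro hi
      obtain ⟨h1, h2⟩ := ih (by omega)
      have hlt : (b i : ℝ) < b (i + 1) := by exact_mod_cast hbmono i (i + 1) (by omega) hi
      have hconst : ∀ t ∈ Set.uIoc (b i : ℝ) (b (i + 1) : ℝ),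
          (p : ℝ) ^ (n - i) / (p : ℝ) ^ n = (Nat.card ↥(lowerSet K vL πL t) : ℝ) /
            (Nat.card ↥(lowerSet K vL πL 0) : ℝ) := by
        intro t ht
        rw [Set.uIoc_of_le hlt.le] at ht
        rw [hcard0, hlow i (by omega) t (fun _ => ht.1) (fun _ => ht.2)]
        have := hcard i (by omega)
        congr 1
        exact_mod_cast this.symm
      have hII : IntervalIntegrable (fun t => (Nat.card ↥(lowerSet K vL πL t) : ℝ) /
          (Nat.card ↥(lowerSet K vL πL 0) : ℝ)) MeasureTheory.volume (b i : ℝ) (b (i + 1) : ℝ) :=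
        IntervalIntegrable.congr (f := fun _ => (p : ℝ) ^ (n - i) / (p : ℝ) ^ n)
          hconst intervalIntegrable_const
      refine ⟨h1.trans hII, ?_⟩
      have hval : ∫ t in (b i : ℝ)..(b (i + 1) : ℝ), (Nat.card ↥(lowerSet K vL πL t) : ℝ) /
          (Nat.card ↥(lowerSet K vL πL 0) : ℝ) =
          ((b (i + 1) : ℝ) - b i) * ((p : ℝ) ^ (n - i) / (p : ℝ) ^ n) := by
        rw [← intervalIntegral.integral_congr_ae (f := fun _ => (p : ℝ) ^ (n - i) / (p : ℝ) ^ n)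
          (Filter.Eventually.of_forall hconst)]
        simp [mul_div_assoc]
      rw [hherb, ← intervalIntegral.integral_add_adjacent_intervals h1 hII, hval]
      rw [hherb] at h2
      rw [h2, hrec i (by omega)]
      have hpw : (p : ℝ) ^ n = (p : ℝ) ^ (n - i) * (p : ℝ) ^ i := by
        rw [← pow_add]; congr 1; omega
      rw [hpw]
      push_cast
      have h3 : (p : ℝ) ^ i ≠ 0 := by positivity
      have h4 : (p : ℝ) ^ (n - i) ≠ 0 := by positivity
      field_simp
      ring
  refine ⟨?_, hlowbr, ?_, ?_⟩
  · intro x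
    constructor
    · rintro ⟨y, hy, rfl⟩
      obtain ⟨i, h1, h2, rfl⟩ := (hlowbr y).1 hy
      exact ⟨i, h1, h2, (hIntg i h2).2⟩
    · rintro ⟨i, h1, h2, rfl⟩
      exact ⟨b i, (hlowbr _).2 ⟨i, h1, h2, rfl⟩, (hIntg i h2).2⟩
  · intro t
    have hex : ∃ i, i = n ∨ t ≤ b (i + 1) := ⟨n, Or.inl rfl⟩
    have hs := Nat.find_spec hex
    have hle : Nat.find hex ≤ n := Nat.find_min' hex (Or.inl rfl)
    have hmin := fun m => Nat.find_min hex (m := m)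
    generalize Nat.find hex = j at hs hle hmin
    refine ⟨j, hle, hlow j hle t ?_ ?_⟩
    · intro hj
      have := hmin (j - 1) (by omega)
      push Not at this
      have h2 := this.2
      rwa [Nat.sub_add_cancel hj] at h2
    · intro hj
      exact hs.resolve_left (by omega)
  · intro i hi
    rcases hi.eq_or_lt with rfl | hlt
    · exact ⟨b i + 1, (hlow i le_rfl _ (fun _ => by linarith) (by omega)).symm⟩
    · exact ⟨b (i + 1), (hlow i hi _ (fun _ => by
        exact_mod_cast hbmono i (i + 1) (by omega) hlt) (fun _ => le_rfl)).symm⟩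
end herb

section fin
variable {K L : Type*} [Field K] [Field L] [Algebra K L]

theorem DVal.G.prod {w : DVal L} {ι : Type*} (S : Finset ι) (N : ι → ℤ) (t : ι → L)
    (h : ∀ s ∈ S, w.G (N s) (t s)) : w.G (∑ s ∈ S, N s) (∏ s ∈ S, t s) := by
  classical
  induction S using Finset.induction_on with
  | empty => simpa using (DVal.E.one (w := w)).G
  | insert x S hx ih =>
    rw [Finset.sum_insert hx, Finset.prod_insert hx]
    exact (h x (Finset.mem_insert_self _ _)).mul
      (ih fun s hs => h s (Finset.mem_insert_of_mem hs))

theorem eval_G (p : ℕ) (hp : p.Prime) [CharP K p] (w : DVal L) {r : ℕ}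
    (Q : MvPolynomial (Fin r) (ZMod p)) (β : Fin r → L) (A : ℤ) (hA : 0 ≤ A)
    (hβ : ∀ k, w.G (-A) (β k)) :
    w.G (-((Q.totalDegree : ℤ) * A))
      (MvPolynomial.eval₂ ((algebraMap K L).comp (ZMod.castHom (dvd_refl p) K)) β Q) := by
  have hF := Fact.mk hp
  rw [MvPolynomial.eval₂_eq]
  refine DVal.G.sum _ _ fun s hs => ?_
  have h1 : w.G 0 (((algebraMap K L).comp (ZMod.castHom (dvd_refl p) K)) (Q.coeff s)) := by
    obtain ⟨k, hk⟩ : ∃ k : ℕ, Q.coeff s = (k : ZMod p) := ⟨_, (ZMod.natCast_zmod_val _).symm⟩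
    rw [hk, map_natCast]
    exact DVal.G.natCast k
  have h2 := DVal.G.prod (w := w) s.support (fun k => (s k : ℤ) * -A) (fun k => β k ^ s k)
    (fun k _ => (hβ k).pow _)
  refine (h1.mul h2).mono ?_
  rw [← Finset.sum_mul, zero_add]
  have h3 := MvPolynomial.le_totalDegree hs
  have h4 : ∑ k ∈ s.support, (s k : ℤ) ≤ Q.totalDegree := by
    rw [Finsupp.sum] at h3
    exact_mod_cast h3
  nlinarith

theorem tower_zero_mem (α : ℕ → L) (x : L) (hx : x ∈ towerField K α 0) :
    ∃ c : K, algebraMap K L c = x := by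
  have h : towerSet α 0 = ∅ := by
    ext y
    simp only [towerSet, Set.mem_ofPred_eq, Set.mem_empty_iff_false, iff_false]
    rintro ⟨j, h1, h2, -⟩
    omega
  rw [towerField, h, IntermediateField.adjoin_empty] at hx
  exact IntermediateField.mem_bot.1 hx

theorem DVal.exists_val (w : DVal L) (k : ℤ) : ∃ x, w.E k x := by
  obtain ⟨π, h0, h1⟩ := w.exists_uniformizer
  have hE : w.E 1 π := ⟨h0, h1⟩
  rcases Int.eq_nat_or_neg k with ⟨m, rfl | rfl⟩
  · exact ⟨_, (hE.pow m).congr (by ring)⟩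
  · exact ⟨_, (hE.pow m).inv.congr (by ring)⟩

theorem lev_zero (p : ℕ) (vK : DVal K) (hperf : vK.PerfectResidue p) (vL : DVal L) (e : ℤ)
    (hepos : 0 < e) (he : ∀ x : K, x ≠ 0 → vL.v (algebraMap K L x) = e * vK.v x) (α : ℕ → L) :
    Lev p vL (towerField K α 0) e where
  pos := hepos
  dvd := by
    intro x hx hx0
    obtain ⟨c, rfl⟩ := tower_zero_mem α x hx
    rw [he c (by rintro rfl; simp at hx0)]
    exact dvd_mul_right _ _
  ex := by
    intro k
    obtain ⟨x, hx⟩ := vK.exists_val k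
    refine ⟨algebraMap K L x, IntermediateField.algebraMap_mem _ _, ?_, ?_⟩
    · simpa using hx.1
    · rw [he x hx.1, hx.2]
  res := by
    intro x hx hG
    obtain ⟨c, rfl⟩ := tower_zero_mem α x hx
    have hup : ∀ z : K, (z = 0 ∨ 0 ≤ vK.v z) → vL.G 0 (algebraMap K L z) := by
      intro z hz
      by_cases h : z = 0
      · left; simp [h]
      · right
        rw [he z h]
        exact mul_nonneg hepos.le (hz.resolve_left h)
    have h1 : c = 0 ∨ 0 ≤ vK.v c := by
      by_cases h : c = 0
      · exact Or.inl h
      · right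
        have := hG.le (by simpa using h)
        rw [he c h] at this
        exact nonneg_of_mul_nonneg_right this hepos
    obtain ⟨y, hy, hxy⟩ := hperf c h1
    refine ⟨algebraMap K L y, IntermediateField.algebraMap_mem _ _, hup y hy, ?_⟩
    rw [← map_pow, ← map_sub]
    by_cases h : c - y ^ p = 0
    · left; simp [h]
    · right
      rw [he _ h]
      have := hxy.resolve_left h
      nlinarith

theorem rank_bound (vK : DVal K) (vL : DVal L) (e : ℕ)
    (he : ∀ x : K, x ≠ 0 → vL.v (algebraMap K L x) = e * vK.v x)
    (πL : L) (hπL : πL ≠ 0 ∧ vL.v πL = 1) (hfd : FiniteDimensional K L) :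
    e ≤ Module.finrank K L := by
  classical
  have hE : vL.E 1 πL := hπL
  have hli : LinearIndependent K (fun k : Fin e => πL ^ (k : ℕ)) := by
    rw [Fintype.linearIndependent_iff]
    intro g hg
    by_contra hne
    push Not at hne
    obtain ⟨i, hi⟩ := hne
    have hval : ∀ s : Fin e, g s ≠ 0 → vL.E (e * vK.v (g s) + (s : ℕ)) (g s • πL ^ (s : ℕ)) := by
      intro s hs
      rw [Algebra.smul_def]
      have h1 : vL.E (e * vK.v (g s)) (algebraMap K L (g s)) := ⟨by simpa using hs, he _ hs⟩
      exact (h1.mul (hE.pow s)).congr (by ring)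
    have hnz : ∀ s : Fin e, g s • πL ^ (s : ℕ) ≠ 0 → g s ≠ 0 := by
      intro s h h'
      rw [h', zero_smul] at h
      exact h rfl
    obtain ⟨s0, -, -, -, h⟩ := DVal.exists_min (w := vL) Finset.univ
      (fun s : Fin e => g s • πL ^ (s : ℕ)) (by
        intro s _ s' _ h1 h2 h3
        rw [(hval s (hnz s h1)).2, (hval s' (hnz s' h2)).2] at h3
        have h4 := congrArg (· % (e : ℤ)) h3
        simp only [Int.mul_add_emod_self_left] at h4
        rw [Int.emod_eq_of_lt (by omega) (by omega), Int.emod_eq_of_lt (by omega) (by omega)] at h4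
        exact Fin.ext (by exact_mod_cast h4)) ⟨i, Finset.mem_univ _, (hval i hi).1⟩
    exact h.1 hg
  have := hli.fintype_card_le_finrank
  simpa using this

theorem tower_core (p n : ℕ) (hp : p.Prime) (hn : 1 ≤ n)
    (G : Type*) [Group G] [Finite G] (hG : Nat.card G = p ^ n)
    (Gser : ℕ → Subgroup G) [∀ j, (Gser j).Normal]
    (htop : Gser 0 = ⊤) (hbot : Gser n = ⊥)
    (hcard : ∀ j, j ≤ n → Nat.card (Gser j) = p ^ (n - j))
    (D : (j : ℕ) → MvPolynomial (Fin (j - 1)) (ZMod p))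
    (hD : IsSaltmanFamily p n G Gser D)
    [CharP K p]
    (vK : DVal K) (hperf : vK.PerfectResidue p)
    (u b : ℕ → ℤ) (hu0 : u 0 = 0) (hb0 : b 0 = 0)
    (hu_pos : ∀ i, 1 ≤ i → i ≤ n → 0 < u i)
    (hu_mono : ∀ i, 1 ≤ i → i + 1 ≤ n → u i < u (i + 1))
    (hu_ndvd : ∀ i, 1 ≤ i → i ≤ n → ¬ (p : ℤ) ∣ u i)
    (hb1 : b 1 = u 1)
    (hbrec : ∀ i, 1 ≤ i → i + 1 ≤ n → b (i + 1) = b i + (p : ℤ) ^ i * (u (i + 1) - u i))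
    (a : ℕ → K) (ha : ∀ i, 1 ≤ i → i ≤ n → a i ≠ 0 ∧ vK.v (a i) = -u i)
    (α : ℕ → L) (d : ℕ → L)
    (hd : ∀ i, d i =
      MvPolynomial.eval₂ ((algebraMap K L).comp (ZMod.castHom (dvd_refl p) K))
        (fun k : Fin (i - 1) => α ((k : ℕ) + 1)) (D i))
    (hα : ∀ i, 1 ≤ i → i ≤ n → α i ^ p - α i = d i + algebraMap K L (a i))
    (hgen : towerField K α n = ⊤)
    (vL : DVal L) (e : ℕ) (hepos : 0 < e)
    (he : ∀ x : K, x ≠ 0 → vL.v (algebraMap K L x) = e * vK.v x)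
    (hinv : ∀ σ : L ≃ₐ[K] L, ∀ x : L, vL.v (σ x) = vL.v x)
    (πL : L) (hπL : πL ≠ 0 ∧ vL.v πL = 1)
    (hmain : ∀ i, 2 ≤ i → i ≤ n → ¬ splitAt Gser i →
      (p : ℤ) ^ (i - 2) * ((D i).totalDegree : ℤ) * u (i - 1) < b i) :
    (IsGalois K L ∧
      ∃ μ : (L ≃ₐ[K] L) ≃* G,
        ∀ i, i ≤ n →
          Subgroup.map μ.toMonoidHom (towerField K α i).fixingSubgroup = Gser i) ∧
    ((e : ℤ) = (p : ℤ) ^ n ∧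
      (∀ x : ℝ, IsUpperBreak K vL πL x ↔ ∃ i, 1 ≤ i ∧ i ≤ n ∧ x = ((u i : ℤ) : ℝ)) ∧
      (∀ x : ℝ, IsLowerBreak K vL πL x ↔ ∃ i, 1 ≤ i ∧ i ≤ n ∧ x = ((b i : ℤ) : ℝ)) ∧
      (∀ i, 1 ≤ i → i ≤ n → vL.v (α i) = -(p : ℤ) ^ (n - 1) * u i)) ∧
    ((∀ t : ℝ, ∃ i, i ≤ n ∧
        lowerSet K vL πL t = ((towerField K α i).fixingSubgroup : Set (L ≃ₐ[K] L))) ∧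
      (∀ i, i ≤ n → ∃ t : ℝ,
        ((towerField K α i).fixingSubgroup : Set (L ≃ₐ[K] L)) = lowerSet K vL πL t)) := by
  haveI := Fact.mk hp
  have hCL : CharP L p := charP_of_injective_algebraMap (algebraMap K L).injective p
  have hp0 : (0 : ℤ) < p := by exact_mod_cast hp.pos
  have hp2 : (2 : ℤ) ≤ p := by exact_mod_cast hp.two_le
  have hrec : ∀ i < n, b (i + 1) = b i + (p : ℤ) ^ i * (u (i + 1) - u i) := by
    intro i hi
    rcases i with _ | i
    · simp [hb0, hu0, hb1]
    · exact hbrec (i + 1) (by omega) hi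
  have hustep : ∀ i < n, u i < u (i + 1) := by
    intro i hi
    rcases i with _ | i
    · rw [hu0]; exact hu_pos _ (by omega) (by omega)
    · exact hu_mono (i + 1) (by omega) hi
  have hbstep : ∀ i < n, b i < b (i + 1) := by
    intro i hi
    rw [hrec i hi]
    have h1 := hustep i hi
    have h2 : (0 : ℤ) < (p : ℤ) ^ i := by positivity
    have : 0 < (p : ℤ) ^ i * (u (i + 1) - u i) := mul_pos h2 (by linarith)
    linarith
  have mono : ∀ f : ℕ → ℤ, (∀ i < n, f i < f (i + 1)) → ∀ i j, i < j → j ≤ n → f i < f j := by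
    intro f hf i j hij
    induction j, hij using Nat.le_induction with
    | base => intro h; exact hf i h
    | succ j hj ih => intro h; exact (ih (by omega)).trans (hf j h)
  have humono := mono u hustep
  have hbmono := mono b hbstep
  have hbpos : ∀ i, 1 ≤ i → i ≤ n → 0 < b i := by
    intro i h1 h2
    have := hbmono 0 i h1 h2
    rwa [hb0] at this
  have hbnd : ∀ i, 1 ≤ i → i ≤ n → ¬ (p : ℤ) ∣ b i := by
    intro i h1
    induction i, h1 using Nat.le_induction with
    | base => intro h; rw [hb1]; exact hu_ndvd 1 le_rfl h
    | succ i h ih =>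
      intro h2 h3
      rw [hrec i h2] at h3
      refine ih (by omega) ((dvd_add_left ?_).1 h3)
      exact dvd_mul_of_dvd_left (dvd_pow_self _ (by omega)) _
  have hbu : ∀ i < n, b (i + 1) ≤ (p : ℤ) ^ i * u (i + 1) := by
    intro i
    induction i with
    | zero => intro _; simp [hb1]
    | succ i ih =>
      intro hi
      have h1 := ih (by omega)
      have h2 := hu_pos (i + 1) (by omega) (by omega)
      rw [hrec (i + 1) hi]
      have h3 : (0 : ℤ) < (p : ℤ) ^ i := by positivity
      have h4 : (p : ℤ) ^ i * u (i + 1) ≤ (p : ℤ) ^ (i + 1) * u (i + 1) := by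
        rw [pow_succ]
        nlinarith [mul_pos h3 h2]
      linarith
  have hlev0 := lev_zero p vK hperf vL e (by exact_mod_cast hepos) he α
  have haE : ∀ i, 1 ≤ i → i ≤ n → vL.E (-((e : ℤ) * u i)) (algebraMap K L (a i)) := by
    intro i h1 h2
    obtain ⟨h3, h4⟩ := ha i h1 h2
    exact ⟨by simpa using h3, by rw [he _ h3, h4]; ring⟩
  have hdmem : ∀ i < n, d (i + 1) ∈ towerField K α i := by
    intro i hi
    rw [hd, MvPolynomial.eval₂_eq]
    refine sum_mem fun m _ => mul_mem (IntermediateField.algebraMap_mem _ _)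
      (prod_mem fun k _ => pow_mem ?_ _)
    exact alpha_mem_tower α (by omega) (by omega)
  have hdG : ∀ i < n, (∀ j < i, ∃ k, vL.E k (α (j + 1)) ∧ (p : ℤ) * k = -((e : ℤ) * u (j + 1))) →
      ∀ m : ℤ, 0 < m → m * (p : ℤ) ^ i = e → vL.G (-(m * b (i + 1)) + 1) (d (i + 1)) := by
    intro i hi hk m hm hme
    obtain ⟨hs1, hs2⟩ := hD.1 (i + 1) (by omega) (by omega)
    by_cases hs : splitAt Gser (i + 1)
    · rw [hd, hs1 hs, MvPolynomial.eval₂_zero]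
      exact DVal.G.zero _
    rcases i with _ | t
    · exfalso
      haveI : IsEmpty (Fin (0 + 1 - 1)) := by simp; infer_instance
      exact hs2 hs _ (MvPolynomial.eq_C_of_isEmpty (D (0 + 1)))
    have hmn := hmain (t + 1 + 1) (by omega) (by omega) hs
    have e1 : t + 1 + 1 - 2 = t := by omega
    have e2 : t + 1 + 1 - 1 = t + 1 := by omega
    rw [e1, congrArg u e2] at hmn
    have hpt : (0 : ℤ) < (p : ℤ) ^ t := by positivity
    have hut := hu_pos (t + 1) (by omega) (by omega)
    have hev := eval_G (K := K) p hp vL (D (t + 1 + 1))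
      (fun k : Fin (t + 1 + 1 - 1) => α ((k : ℕ) + 1)) (m * (p : ℤ) ^ t * u (t + 1))
      (by positivity) (by
        intro k
        have hkl : (k : ℕ) < t + 1 := by have := k.2; omega
        obtain ⟨r, hr, hpr⟩ := hk k hkl
        refine hr.G.mono ?_
        have hr2 : r = -(m * (p : ℤ) ^ t * u (k + 1)) := by
          refine mul_left_cancel₀ hp0.ne' ?_
          rw [hpr, ← hme]; ring
        rw [hr2]
        have hle : u (k + 1) ≤ u (t + 1) := by
          rcases Nat.lt_or_ge k t with h | h
          · exact (humono _ _ (by omega) (by omega)).le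
          · have : (k : ℕ) = t := by omega
            rw [this]
        have : 0 < m * (p : ℤ) ^ t := by positivity
        nlinarith)
    rw [hd]
    refine hev.mono ?_
    have : m * ((p : ℤ) ^ t * ((D (t + 1 + 1)).totalDegree : ℤ) * u (t + 1)) ≤
        m * (b (t + 1 + 1) - 1) := mul_le_mul_of_nonneg_left (by omega) hm.le
    nlinarith
  have hst := tower_steps p n hp vL e α d a u b hu0 hb0 hrec humono hu_ndvd hbnd hbpos hbu
    hlev0 haE hdmem hα hdG
  have hepn : (e : ℤ) = (p : ℤ) ^ n := by
    obtain ⟨⟨m, y, hm, hS, -⟩, -⟩ := hst (n - 1) (by omega)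
    have hlev := hS.lev' hp
    rw [Nat.sub_add_cancel hn] at hlev hm
    have h1 := hlev.dvd πL (by rw [hgen]; exact IntermediateField.mem_top) hπL.1
    rw [hπL.2] at h1
    have h2 : m = 1 := Int.eq_one_of_dvd_one hlev.pos.le h1
    rw [← hm, h2, one_mul]
  have hepn' : e = p ^ n := by exact_mod_cast hepn
  have hvα : ∀ i, 1 ≤ i → i ≤ n → vL.v (α i) = -(p : ℤ) ^ (n - 1) * u i := by
    intro i h1 h2
    obtain ⟨i, rfl⟩ : ∃ k, i = k + 1 := ⟨i - 1, by omega⟩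
    obtain ⟨-, k, hk, hpk⟩ := hst i (by omega)
    rw [hk.2]
    refine mul_left_cancel₀ hp0.ne' ?_
    have h3 : (p : ℤ) ^ n = p * (p : ℤ) ^ (n - 1) := by
      rw [← pow_succ']; congr 1; omega
    rw [hpk, hepn, h3]; ring
  have hrank : FiniteDimensional K L → p ^ n ≤ Module.finrank K L := by
    intro hfd
    rw [← hepn']
    exact rank_bound vK vL e he πL hπL hfd
  obtain ⟨ρ, hρ⟩ := hD.2
  have hSol : Sol p K D a n α := by
    intro j h1 h2
    rw [hα j h1 h2, hd]
    rfl
  have hgalois := tower_galois p n hp hn hG Gser htop hbot D a α ρ (hρ n hn le_rfl).2.1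
    (fun i h1 h2 => (hρ i h1 h2).2.2.1) (fun i h1 h2 => (hρ i h1 h2).2.2.2) hSol hgen hrank
  refine ⟨hgalois, ?_⟩
  obtain ⟨-, μ, hμ⟩ := hgalois
  have hfinal := ram_final p n hp hn vL πL (fun i => (towerField K α i).fixingSubgroup)
    (by
      rw [eq_top_iff]
      intro σ _
      rw [tower_ext]
      intro j h1 h2
      omega)
    (by
      change (towerField K α n).fixingSubgroup = ⊥
      rw [hgen, IntermediateField.fixingSubgroup_top])
    (by
      intro i j hij σ hσ
      rw [tower_ext] at hσ ⊢
      intro k h1 h2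
      exact hσ k h1 (by omega))
    (by
      intro i hi
      rw [← hcard i hi, ← hμ i hi]
      exact Nat.card_congr (Subgroup.equivMapOfInjective _ _ μ.injective).toEquiv)
    u b hu0 hb0 hrec hbmono
    (by
      intro i hi σ hσ hσ'
      have hne : σ (α (i + 1)) ≠ α (i + 1) := by
        intro h
        apply hσ'
        rw [tower_ext] at hσ ⊢
        intro j h1 h2
        rcases Nat.lt_or_ge i j with hj | hj
        · have : j = i + 1 := by omega
          rw [this]; exact h
        · exact hσ j h1 hj
      obtain ⟨m, hm, hact⟩ := tower_act p n hp vL e α u b hbpos hbmono hst σ (hinv σ) i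
        ((IntermediateField.mem_fixingSubgroup_iff _ _).1 hσ) hne n hi le_rfl
      have hm1 : m = 1 := by
        have h1 : (0 : ℤ) < (p : ℤ) ^ n := by positivity
        refine mul_right_cancel₀ h1.ne' ?_
        rw [hm, hepn, one_mul]
      subst hm1
      rw [hgen] at hact
      have hb := hbpos (i + 1) (by omega) hi
      have hin : inInertia K vL σ := by
        intro x hx
        by_cases h : x = 0
        · left; simp [h]
        · have h1 := (hact x IntermediateField.mem_top h).1
          have h2 := hx.resolve_left h
          exact h1.mono (by omega)
      rw [ramNum, if_pos hin]
      have h1 := (hact πL IntermediateField.mem_top hπL.1).2 (by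
        rw [hπL.2]
        intro h
        have := Int.le_of_dvd one_pos h
        omega)
      rw [h1.2, hπL.2]
      ring)
  exact ⟨⟨hepn, hfinal.1, hfinal.2.1, hvα⟩, hfinal.2.2.1, hfinal.2.2.2⟩
end fin

open MvPolynomial in
theorem tower_ramification_of_degree_bound (p n : ℕ) (hp : p.Prime) (hn : 1 ≤ n)
    (G : Type*) [Group G] [Finite G] (hG : Nat.card G = p ^ n)
    (Gser : ℕ → Subgroup G) [∀ j, (Gser j).Normal]
    (htop : Gser 0 = ⊤) (hbot : Gser n = ⊥)
    (hlt : ∀ j, j < n → Gser (j + 1) < Gser j)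
    (hcard : ∀ j, j ≤ n → Nat.card (Gser j) = p ^ (n - j))
    (D : (j : ℕ) → MvPolynomial (Fin (j - 1)) (ZMod p))
    (hD : IsSaltmanFamily p n G Gser D)
    (K : Type*) [Field K] [CharP K p]
    (vK : DVal K) (hcomplete : vK.IsComplete) (hperf : vK.PerfectResidue p)
    (u b : ℕ → ℤ)
    (hu_pos : ∀ i, 1 ≤ i → i ≤ n → 0 < u i)
    (hu_mono : ∀ i, 1 ≤ i → i + 1 ≤ n → u i < u (i + 1))
    (hu_ndvd : ∀ i, 1 ≤ i → i ≤ n → ¬ (p : ℤ) ∣ u i)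
    (hb1 : b 1 = u 1)
    (hbrec : ∀ i, 1 ≤ i → i + 1 ≤ n → b (i + 1) = b i + (p : ℤ) ^ i * (u (i + 1) - u i))
    (a : ℕ → K) (ha : ∀ i, 1 ≤ i → i ≤ n → a i ≠ 0 ∧ vK.v (a i) = -u i)
    (L : Type*) [Field L] [Algebra K L]
    (α : ℕ → L) (d : ℕ → L)
    (hd : ∀ i, d i =
      eval₂ ((algebraMap K L).comp (ZMod.castHom (dvd_refl p) K))
        (fun k : Fin (i - 1) => α ((k : ℕ) + 1)) (D i))
    (hα : ∀ i, 1 ≤ i → i ≤ n → α i ^ p - α i = d i + algebraMap K L (a i))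
    (hgen : towerField K α n = ⊤)
    (vL : DVal L) (e : ℕ) (hepos : 0 < e)
    (he : ∀ x : K, x ≠ 0 → vL.v (algebraMap K L x) = e * vK.v x)
    (hinv : ∀ σ : L ≃ₐ[K] L, ∀ x : L, vL.v (σ x) = vL.v x)
    (πL : L) (hπL : πL ≠ 0 ∧ vL.v πL = 1)
    -- main hypothesis: b_i > p^{i-2} l_i u_{i-1} for all i ∉ Σ_G, where
    -- l_i is the total degree of D_i
    (hmain : ∀ i, 2 ≤ i → i ≤ n → ¬ splitAt Gser i →
      (p : ℤ) ^ (i - 2) * ((D i).totalDegree : ℤ) * u (i - 1) < b i) :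
    -- (a)
    (IsGalois K L ∧
      ∃ μ : (L ≃ₐ[K] L) ≃* G,
        ∀ i, i ≤ n →
          Subgroup.map μ.toMonoidHom (towerField K α i).fixingSubgroup = Gser i) ∧
    -- (b)
    ((e : ℤ) = (p : ℤ) ^ n ∧
      (∀ x : ℝ, IsUpperBreak K vL πL x ↔ ∃ i, 1 ≤ i ∧ i ≤ n ∧ x = ((u i : ℤ) : ℝ)) ∧
      (∀ x : ℝ, IsLowerBreak K vL πL x ↔ ∃ i, 1 ≤ i ∧ i ≤ n ∧ x = ((b i : ℤ) : ℝ)) ∧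
      (∀ i, 1 ≤ i → i ≤ n → vL.v (α i) = -(p : ℤ) ^ (n - 1) * u i)) ∧
    -- (c)
    ((∀ t : ℝ, ∃ i, i ≤ n ∧
        lowerSet K vL πL t = ((towerField K α i).fixingSubgroup : Set (L ≃ₐ[K] L))) ∧
      (∀ i, i ≤ n → ∃ t : ℝ,
        ((towerField K α i).fixingSubgroup : Set (L ≃ₐ[K] L)) = lowerSet K vL πL t)) := by
  have hrest := tower_core (K := K) (L := L) p n hp hn G hG Gser htop hbot hcard D hD vK hperf
    (fun i => if i = 0 then 0 else u i) (fun i => if i = 0 then 0 else b i) (by simp) (by simp)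
    (by
      intro i h1 h2
      rw [if_neg (by omega)]
      exact hu_pos i h1 h2)
    (by
      intro i h1 h2
      rw [if_neg (by omega), if_neg (by omega)]
      exact hu_mono i h1 h2)
    (by
      intro i h1 h2
      rw [if_neg (by omega)]
      exact hu_ndvd i h1 h2)
    (by simpa using hb1)
    (by
      intro i h1 h2
      rw [if_neg (by omega), if_neg (by omega), if_neg (by omega), if_neg (by omega)]
      exact hbrec i h1 h2)
    a
    (by
      intro i h1 h2
      rw [if_neg (by omega)]
      exact ha i h1 h2)
    α d hd hα hgen vL e hepos he hinv πL hπL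
    (by
      intro i h1 h2 h3
      rw [if_neg (by omega), if_neg (by omega)]
      exact hmain i h1 h2 h3)
  have hconv : ∀ (f : ℕ → ℤ) (x : ℝ),
      (∃ i, 1 ≤ i ∧ i ≤ n ∧ x = (((if i = 0 then 0 else f i) : ℤ) : ℝ)) ↔
        ∃ i, 1 ≤ i ∧ i ≤ n ∧ x = ((f i : ℤ) : ℝ) := by
    intro f x
    constructor
    · rintro ⟨i, h1, h2, h3⟩
      rw [if_neg (by omega)] at h3
      exact ⟨i, h1, h2, h3⟩
    · rintro ⟨i, h1, h2, h3⟩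
      refine ⟨i, h1, h2, ?_⟩
      rw [if_neg (by omega)]
      exact h3
  obtain ⟨hA, ⟨hB1, hB2, hB3, hB4⟩, hC⟩ := hrest
  refine ⟨hA, ⟨hB1, fun x => (hB2 x).trans (hconv u x), fun x => (hB3 x).trans (hconv b x), ?_⟩, hC⟩
  intro i h1 h2
  have h3 := hB4 i h1 h2
  rw [if_neg (by omega)] at h3
  exact h3
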